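/- Let n ≥ 2. Draw an n-qubit unitary U as follows: independently for i = 1, …, R, draw a position j_i uniformly at random from {1, …, n−1} and a gate u_i Haar-randomly from SU(4), and set U = (u_R)_{(j_R, j_R+1)} ··· (u_1)_{(j_1, j_1+1)}. Then for every α ∈ [0,1) with α·R/(n(n−1)²) ≤ 4^n − 1, the probability (over both positions and gates) that C_u(U) ≥ α·R/(9n(n−1)²) − n/3 is at least 1 − (n−1)e^{−n}/(1−α). -/

import Mathlib

open scoped Matrix ENNReal Classical Kronecker ComplexOrder
open MeasureTheory

/-! ## Basic objects: qubit bases, gates, architectures, contraction maps -/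

/-- Computational-basis index set for `n` qubits. -/
abbrev QubitBasis (n : ℕ) := Fin n → Fin 2

/-- `2^n × 2^n` complex matrices, indexed by the computational basis of `n` qubits. -/
abbrev NMatrix (n : ℕ) := Matrix (QubitBasis n) (QubitBasis n) ℂ

/-- The special unitary group `SU(4)` of two-qubit gates. -/
abbrev SU4 := Matrix.specialUnitaryGroup (Fin 4) ℂ

/-- An architecture on `n` qubits with `R` gates: a list of ordered pairs of distinct qubits. -/
def Architecture (n R : ℕ) := Fin R → {p : Fin n × Fin n // p.1 ≠ p.2}

/-- Identification of a pair of one-qubit basis indices with a two-qubit basis index. -/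
def pairIdx (a b : Fin 2) : Fin 4 := ⟨2 * a.val + b.val, by omega⟩

/-- The `n`-qubit matrix given by letting the two-qubit matrix `u` act on the
tensor factors `p.1` and `p.2`, and as the identity on all other factors. -/
noncomputable def embedGate {n : ℕ} (p : Fin n × Fin n) (u : Matrix (Fin 4) (Fin 4) ℂ) :
    NMatrix n := fun a b =>
  if (∀ i, i ≠ p.1 → i ≠ p.2 → a i = b i)
  then u (pairIdx (a p.1) (a p.2)) (pairIdx (b p.1) (b p.2)) else 0

/-- The list of `n`-qubit gates obtained by substituting the gates `x` into
the architecture `A`. -/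
noncomputable def gateList {n R : ℕ} (A : Architecture n R) (x : Fin R → SU4) :
    List (NMatrix n) :=
  List.ofFn fun i => embedGate (A i).1 (x i : Matrix (Fin 4) (Fin 4) ℂ)

/-- The contraction map `F^A` of an architecture `A`: it sends a tuple of two-qubit gates
`(u_1, …, u_R)` to the `n`-qubit unitary `(u_R)_{p_R} ⋯ (u_1)_{p_1}`. -/
noncomputable def contract {n R : ℕ} (A : Architecture n R) (x : Fin R → SU4) : NMatrix n :=
  ((gateList A x).reverse).prod

/-- The exact circuit complexity: the least number `R` of two-qubit gates, arranged in any
architecture, implementing the matrix `U`. -/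
noncomputable def Cu (n : ℕ) (U : NMatrix n) : ℕ :=
  sInf {R | ∃ A : Architecture n R, ∃ x : Fin R → SU4, contract A x = U}

/-- The all-zeros computational basis state `|0^n⟩`. -/
noncomputable def ket0 (n : ℕ) : QubitBasis n → ℂ := fun a => if a = fun _ => 0 then 1 else 0

/-- The exact state complexity: the least number `R` of two-qubit gates, arranged in any
architecture, producing `ψ` from `|0^n⟩`. -/
noncomputable def Cstate (n : ℕ) (ψ : QubitBasis n → ℂ) : ℕ :=
  sInf {R | ∃ A : Architecture n R, ∃ x : Fin R → SU4, (contract A x) *ᵥ ket0 n = ψ}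

/-- The gates with indices `lo ≤ i < hi` of `A` form a causal slice with sink qubit `t`:
every qubit `q` is connected to `t` by a path through gates of the slice, taken in
increasing index order. -/
def IsCausalSliceWith {n R : ℕ} (A : Architecture n R) (lo hi : ℕ) (t : Fin n) : Prop :=
  ∀ q : Fin n, ∃ (m : ℕ) (idx : Fin m → Fin R) (qs : Fin (m + 1) → Fin n),
    StrictMono idx ∧ (∀ l, lo ≤ (idx l : ℕ) ∧ (idx l : ℕ) < hi) ∧
    qs 0 = q ∧ qs (Fin.last m) = t ∧
    ∀ l : Fin m,
      (qs l.castSucc = (A (idx l)).1.1 ∨ qs l.castSucc = (A (idx l)).1.2) ∧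
      (qs l.succ = (A (idx l)).1.1 ∨ qs l.succ = (A (idx l)).1.2)

/-- The gates with indices `lo ≤ i < hi` of `A` form a causal slice. -/
def IsCausalSlice {n R : ℕ} (A : Architecture n R) (lo hi : ℕ) : Prop :=
  ∃ t, IsCausalSliceWith A lo hi t

/-! ## Group, topological, measurable and compactness structure on `SU(4)`,
and its Haar probability measure -/

namespace SU4

theorem star_mem {U : Matrix (Fin 4) (Fin 4) ℂ}
    (hU : U ∈ Matrix.specialUnitaryGroup (Fin 4) ℂ) :
    star U ∈ Matrix.specialUnitaryGroup (Fin 4) ℂ := by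
  rw [Matrix.mem_specialUnitaryGroup_iff] at hU ⊢
  refine ⟨Unitary.star_mem hU.1, ?_⟩
  have : (star U).det = star U.det := by
    simp [Matrix.star_eq_conjTranspose, Matrix.det_conjTranspose]
  rw [this, hU.2]
  simp

noncomputable instance : Group SU4 :=
  { (inferInstance : Monoid SU4) with
    inv := fun U => ⟨star U.1, star_mem U.2⟩
    inv_mul_cancel := fun U => Subtype.ext <| by
      have h := (Matrix.mem_specialUnitaryGroup_iff.mp U.2).1.1
      simpa using h }

instance : IsTopologicalGroup SU4 where
  continuous_mul := by
    apply Continuous.subtype_mk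
    exact ((continuous_subtype_val.comp continuous_fst).matrix_mul
      (continuous_subtype_val.comp continuous_snd))
  continuous_inv := by
    apply Continuous.subtype_mk
    exact continuous_star.comp continuous_subtype_val

noncomputable instance : MeasurableSpace (Matrix (Fin 4) (Fin 4) ℂ) :=
  inferInstanceAs (MeasurableSpace (Fin 4 → Fin 4 → ℂ))

instance : BorelSpace (Matrix (Fin 4) (Fin 4) ℂ) :=
  inferInstanceAs (BorelSpace (Fin 4 → Fin 4 → ℂ))

theorem isClosed :
    IsClosed (Matrix.specialUnitaryGroup (Fin 4) ℂ : Set (Matrix (Fin 4) (Fin 4) ℂ)) := by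
  have h1 : IsClosed {M : Matrix (Fin 4) (Fin 4) ℂ | star M * M = 1} :=
    isClosed_eq ((continuous_id.matrix_conjTranspose).matrix_mul continuous_id) continuous_const
  have h2 : IsClosed {M : Matrix (Fin 4) (Fin 4) ℂ | M * star M = 1} :=
    isClosed_eq (continuous_id.matrix_mul (continuous_id.matrix_conjTranspose)) continuous_const
  have h3 : IsClosed {M : Matrix (Fin 4) (Fin 4) ℂ | M.det = 1} :=
    isClosed_eq continuous_id.matrix_det continuous_const
  have : (Matrix.specialUnitaryGroup (Fin 4) ℂ : Set (Matrix (Fin 4) (Fin 4) ℂ)) =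
      ({M | star M * M = 1} ∩ {M | M * star M = 1}) ∩ {M | M.det = 1} := by
    ext M
    simp only [SetLike.mem_coe, Matrix.mem_specialUnitaryGroup_iff, Unitary.mem_iff,
      Set.mem_inter_iff, Set.mem_setOf_eq]
  rw [this]
  exact ((h1.inter h2)).inter h3

theorem isCompact :
    IsCompact (Matrix.specialUnitaryGroup (Fin 4) ℂ : Set (Matrix (Fin 4) (Fin 4) ℂ)) := by
  have hK : IsCompact (Set.pi Set.univ fun _ : Fin 4 => Set.pi Set.univ fun _ : Fin 4 =>
      Metric.closedBall (0 : ℂ) 1 : Set (Matrix (Fin 4) (Fin 4) ℂ)) :=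
    isCompact_univ_pi fun _ => isCompact_univ_pi fun _ => isCompact_closedBall _ _
  refine IsCompact.of_isClosed_subset hK isClosed ?_
  intro M hM
  refine fun i _ => fun j _ => ?_
  simp only [Metric.mem_closedBall, dist_zero_right]
  exact entry_norm_bound_of_unitary (Matrix.mem_specialUnitaryGroup_iff.mp hM).1 i j

instance : CompactSpace SU4 :=
  isCompact_iff_compactSpace.mp isCompact

noncomputable instance : MeasurableSpace SU4 := borel SU4

instance : BorelSpace SU4 := ⟨rfl⟩

end SU4

/-- The Haar probability measure on `SU(4)`. -/
noncomputable def haarSU4 : Measure SU4 :=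
  Measure.haarMeasure ⟨⟨Set.univ, isCompact_univ⟩, by simp⟩

instance : IsProbabilityMeasure haarSU4 := by
  constructor
  have h : Measure.haarMeasure
      (⟨⟨Set.univ, isCompact_univ⟩, by simp⟩ : TopologicalSpace.PositiveCompacts SU4)
      (⟨⟨Set.univ, isCompact_univ⟩, by simp⟩ : TopologicalSpace.PositiveCompacts SU4) = 1 :=
    Measure.haarMeasure_self
  simpa [haarSU4] using h

/-- The product of Haar probability measures on `SU(4)^{×R}`: the distribution of a random
quantum circuit with `R` gates in a fixed architecture. -/
noncomputable def muSU4 (R : ℕ) : Measure (Fin R → SU4) :=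
  Measure.pi fun _ => haarSU4

/-! ## The differential of the contraction map, its rank, and the accessible dimension -/

/-- The Lie algebra `su(m)` of traceless skew-Hermitian matrices, as a real subspace. -/
noncomputable def suAlgebra (m : Type*) [Fintype m] [DecidableEq m] :
    Submodule ℝ (Matrix m m ℂ) :=
  Submodule.span ℝ {H | Hᴴ = -H ∧ H.trace = 0}

/-- `embedGate` as a real-linear map in the gate entry. -/
noncomputable def embedLin {n : ℕ} (p : Fin n × Fin n) :
    Matrix (Fin 4) (Fin 4) ℂ →ₗ[ℝ] NMatrix n where
  toFun := embedGate p
  map_add' u v := by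
    funext a b
    simp only [embedGate, Matrix.add_apply]
    split <;> simp
  map_smul' r u := by
    funext a b
    simp only [embedGate, Matrix.smul_apply, RingHom.id_apply]
    split <;> simp

/-- The differential of the contraction map `F^A` at the point `x ∈ SU(4)^{×R}`, read in the
exponential charts: the direction `(H_1, …, H_R)` is mapped to
`∑_j (U_R)_{p_R} ⋯ (U_{j+1})_{p_{j+1}} · (H_j)_{p_j} · (U_j)_{p_j} ⋯ (U_1)_{p_1}`. -/
noncomputable def contractDiff {n R : ℕ} (A : Architecture n R) (x : Fin R → SU4) :
    (Fin R → Matrix (Fin 4) (Fin 4) ℂ) →ₗ[ℝ] NMatrix n :=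
  ∑ j : Fin R,
    (LinearMap.mulLeft ℝ (((gateList A x).drop (j + 1)).reverse.prod)) ∘ₗ
      (LinearMap.mulRight ℝ
        (embedGate (A j).1 (x j : Matrix (Fin 4) (Fin 4) ℂ) *
          ((gateList A x).take j).reverse.prod)) ∘ₗ
      (embedLin (A j).1) ∘ₗ
      (LinearMap.proj j)

/-- The rank of (the differential of) the contraction map `F^A` at `x`: the dimension of
the image, under the differential, of the tangent space `su(4)^{×R}`. -/
noncomputable def rankAt {n R : ℕ} (A : Architecture n R) (x : Fin R → SU4) : ℕ :=
  Module.finrank ℝ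
    ↥(Submodule.map (contractDiff A x) (Submodule.pi Set.univ fun _ => suAlgebra (Fin 4)))

/-- The maximal rank `r_max` of the contraction map `F^A` over all points of `SU(4)^{×R}`. -/
noncomputable def rmax {n R : ℕ} (A : Architecture n R) : ℕ := ⨆ x, rankAt A x

/-- A matrix viewed as a point of the Euclidean (Frobenius) space of its entries. -/
noncomputable def toEuc {n : ℕ} (M : NMatrix n) :
    EuclideanSpace ℂ (QubitBasis n × QubitBasis n) := WithLp.toLp 2 fun p => M p.1 p.2

/-- The Frobenius norm `‖X‖_F = (tr (X† X))^{1/2}` of an `n`-qubit matrix. -/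
noncomputable def frobNorm {n : ℕ} (M : NMatrix n) : ℝ := ‖toEuc M‖

/-- The accessible dimension `d_A` of an architecture `A`: the Hausdorff dimension of the
set `U(A)` of unitaries implementable with `A`, with respect to the Frobenius metric. -/
noncomputable def accessibleDim {n R : ℕ} (A : Architecture n R) : ℝ≥0∞ :=
  dimH (toEuc '' Set.range (contract A))

/-! ## Pauli strings and Clifford gates -/

/-- The Pauli matrices `1, X, Y, Z`. -/
noncomputable def pauli : Fin 4 → Matrix (Fin 2) (Fin 2) ℂ
  | 0 => 1
  | 1 => !![0, 1; 1, 0]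
  | 2 => !![0, -Complex.I; Complex.I, 0]
  | 3 => !![1, 0; 0, -1]

/-- The `n`-qubit Pauli string `⨂ᵢ pauli (s i)`. -/
noncomputable def pauliString {n : ℕ} (s : Fin n → Fin 4) : NMatrix n :=
  fun a b => ∏ i, pauli (s i) (a i) (b i)

/-- A two-qubit Pauli string, as a `4 × 4` matrix. -/
noncomputable def pauli2 (s : Fin 2 → Fin 4) : Matrix (Fin 4) (Fin 4) ℂ :=
  fun a b =>
    pauli (s 0) ⟨a.val / 2, by have := a.isLt; omega⟩ ⟨b.val / 2, by have := b.isLt; omega⟩ *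
    pauli (s 1) ⟨a.val % 2, by have := a.isLt; omega⟩ ⟨b.val % 2, by have := b.isLt; omega⟩

/-- A two-qubit gate is Clifford if it maps every Pauli string to a scalar multiple of a
Pauli string under conjugation. -/
def IsCliffordGate (u : Matrix (Fin 4) (Fin 4) ℂ) : Prop :=
  ∀ s : Fin 2 → Fin 4, ∃ (c : ℂ) (s' : Fin 2 → Fin 4),
    u * pauli2 s * uᴴ = c • pauli2 s'

/-- Application to the state `|0^n⟩`, `M ↦ M |0^n⟩`, as a real-linear map. -/
noncomputable def mulVecKet0 (n : ℕ) : NMatrix n →ₗ[ℝ] (QubitBasis n → ℂ) where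
  toFun M := M *ᵥ ket0 n
  map_add' M N := Matrix.add_mulVec M N (ket0 n)
  map_smul' r M := by
    simp only [RingHom.id_apply]
    exact Matrix.smul_mulVec r M (ket0 n)

/-- The rank of (the differential of) the map `G^A : x ↦ F^A(x)|0^n⟩` at `x`. -/
noncomputable def stateRankAt {n R : ℕ} (A : Architecture n R) (x : Fin R → SU4) : ℕ :=
  Module.finrank ℝ
    ↥(Submodule.map ((mulVecKet0 n) ∘ₗ contractDiff A x)
      (Submodule.pi Set.univ fun _ => suAlgebra (Fin 4)))

/-! ## Trace norm and operator norm -/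

/-- The positive semidefinite square root of a positive semidefinite matrix (the definition of
the older Mathlib, since removed). -/
noncomputable def Matrix.PosSemidef.sqrt {m 𝕜 : Type*} [Fintype m] [RCLike 𝕜] [DecidableEq m]
    {A : Matrix m m 𝕜} (hA : A.PosSemidef) : Matrix m m 𝕜 :=
  hA.1.eigenvectorUnitary.1 * Matrix.diagonal ((↑) ∘ Real.sqrt ∘ hA.1.eigenvalues) *
    (star hA.1.eigenvectorUnitary : Matrix m m 𝕜)

/-- The trace norm `‖M‖₁ = tr ((M† M)^{1/2})` of a square complex matrix. -/
noncomputable def traceNorm {m : Type*} [Fintype m] [DecidableEq m] (M : Matrix m m ℂ) : ℝ :=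
  ((Matrix.posSemidef_conjTranspose_mul_self M).sqrt.trace).re

/-- The operator norm (largest singular value) of a square complex matrix: the norm of the
induced operator between Euclidean spaces. -/
noncomputable def opNorm {m : Type*} [Fintype m] [DecidableEq m] (M : Matrix m m ℂ) : ℝ :=
  ‖LinearMap.toContinuousLinearMap (Matrix.toEuclideanLin M)‖

/-! ## The uniform measure on a finite index set -/

/-- The uniform probability measure on `Fin m`. -/
noncomputable def uniformFin (m : ℕ) : Measure (Fin m) :=
  ((m : ℝ≥0∞))⁻¹ • Measure.count

instance (m : ℕ) : IsFiniteMeasure (uniformFin m) := by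
  constructor
  rw [uniformFin, Measure.smul_apply, smul_eq_mul, Measure.count_univ, ENat.card_eq_coe_fintype_card,
    Fintype.card_fin, ENat.toENNReal_coe]
  rcases Nat.eq_zero_or_pos m with h | h
  · simp [h]
  · rw [ENNReal.inv_mul_cancel (by exact_mod_cast h.ne') (by simp)]
    exact ENNReal.one_lt_top

/-! ## Statement 9: randomized architectures -/

/-- The architecture determined by a tuple of positions: the `i`-th gate acts on the
(neighboring) qubits `pos i` and `pos i + 1`. -/
def archOfPositions {n R : ℕ} (hn : 2 ≤ n) (pos : Fin R → Fin (n - 1)) : Architecture n R :=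
  fun i =>
    ⟨(⟨(pos i).val, by have := (pos i).isLt; omega⟩,
      ⟨(pos i).val + 1, by have := (pos i).isLt; omega⟩),
      Fin.ne_of_val_ne (by show (pos i).val ≠ (pos i).val + 1; omega)⟩

/-- The distribution of a doubly random circuit with `R` gates: positions are drawn uniformly
at random from `{1, …, n−1}` and gates Haar-randomly from `SU(4)`, all independently. -/
noncomputable def muDoublyRandom (n R : ℕ) :
    Measure ((Fin R → Fin (n - 1)) × (Fin R → SU4)) :=
  (Measure.pi fun _ => uniformFin (n - 1)).prod (Measure.pi fun _ => haarSU4)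

namespace RA

abbrev M2 := Matrix (Fin 2) (Fin 2) ℂ
abbrev M4 := Matrix (Fin 4) (Fin 4) ℂ

def pairEquiv : Fin 2 × Fin 2 ≃ Fin 4 where
  toFun x := pairIdx x.1 x.2
  invFun i := (⟨i.val / 2, by omega⟩, ⟨i.val % 2, by omega⟩)
  left_inv := by decide
  right_inv := by decide

lemma pairIdx_inj {x y x' y' : Fin 2} (h : pairIdx x y = pairIdx x' y') : x = x' ∧ y = y' := by
  revert x y x' y'; decide

/-- Kronecker product of two one-qubit matrices, indexed by `Fin 4`. -/
noncomputable def kron2 (a b : M2) : M4 :=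
  (a ⊗ₖ b).submatrix pairEquiv.symm pairEquiv.symm

lemma kron2_apply (a b : M2) (x y x' y' : Fin 2) :
    kron2 a b (pairIdx x y) (pairIdx x' y') = a x x' * b y y' := by
  have h1 : pairIdx x y = pairEquiv (x, y) := rfl
  have h2 : pairIdx x' y' = pairEquiv (x', y') := rfl
  simp [kron2, h1, h2]

lemma kron2_mul (a b a' b' : M2) : kron2 a b * kron2 a' b' = kron2 (a * a') (b * b') := by
  simp [kron2, Matrix.submatrix_mul_equiv, Matrix.mul_kronecker_mul]

lemma kron2_one : kron2 1 1 = 1 := by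
  simp [kron2]

lemma kron2_det (a b : M2) : (kron2 a b).det = a.det ^ 2 * b.det ^ 2 := by
  simp [kron2, Matrix.det_submatrix_equiv_self, Matrix.det_kronecker]

lemma kron2_conjTranspose (a b : M2) : (kron2 a b)ᴴ = kron2 aᴴ bᴴ := by
  simp [kron2, Matrix.conjTranspose_submatrix, Matrix.conjTranspose_kronecker]

lemma sum_pair (f : Fin 4 → ℂ) : ∑ i, f i = ∑ x : Fin 2, ∑ y : Fin 2, f (pairIdx x y) := by
  rw [← Fintype.sum_prod_type', ← pairEquiv.sum_comp]; rfl

variable {n : ℕ}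

def upd (p : Fin n × Fin n) (a : QubitBasis n) (x y : Fin 2) : QubitBasis n :=
  Function.update (Function.update a p.1 x) p.2 y

lemma upd_fst {p : Fin n × Fin n} (hp : p.1 ≠ p.2) (a : QubitBasis n) (x y : Fin 2) :
    upd p a x y p.1 = x := by simp [upd, hp]

lemma upd_snd {p : Fin n × Fin n} (a : QubitBasis n) (x y : Fin 2) :
    upd p a x y p.2 = y := by simp [upd]

lemma upd_other {p : Fin n × Fin n} (a : QubitBasis n) (x y : Fin 2) {i : Fin n}
    (h1 : i ≠ p.1) (h2 : i ≠ p.2) : upd p a x y i = a i := by simp [upd, h1, h2]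

lemma embed_mul_apply {p : Fin n × Fin n} (hp : p.1 ≠ p.2) (u : M4) (M : NMatrix n)
    (a c : QubitBasis n) :
    (embedGate p u * M) a c =
      ∑ x, ∑ y, u (pairIdx (a p.1) (a p.2)) (pairIdx x y) * M (upd p a x y) c := by
  rw [Matrix.mul_apply, ← Fintype.sum_prod_type']
  symm
  refine Finset.sum_of_injOn (fun z : Fin 2 × Fin 2 => upd p a z.1 z.2) ?_ (by simp) ?_ ?_
  · rintro ⟨x, y⟩ - ⟨x', y'⟩ - h
    have h1 := congrFun h p.1
    have h2 := congrFun h p.2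
    simp only [upd_fst hp, upd_snd] at h1 h2
    rw [h1, h2]
  · intro b _ hb
    have : ¬ (∀ i, i ≠ p.1 → i ≠ p.2 → a i = b i) := by
      intro h
      apply hb
      refine ⟨(b p.1, b p.2), by simp, ?_⟩
      funext i
      by_cases h2 : i = p.2
      · subst h2; simp [upd_snd]
      by_cases h1 : i = p.1
      · subst h1; simp [upd_fst hp]
      simp [upd_other _ _ _ h1 h2, h i h1 h2]
    simp [embedGate, this]
  · rintro ⟨x, y⟩ -
    have : (∀ i, i ≠ p.1 → i ≠ p.2 → a i = upd p a x y i) := by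
      intro i h1 h2
      rw [upd_other _ _ _ h1 h2]
    simp only [embedGate]
    rw [if_pos this, upd_fst hp, upd_snd]

lemma embed_mul {p : Fin n × Fin n} (hp : p.1 ≠ p.2) (u v : M4) :
    embedGate p u * embedGate p v = embedGate p (u * v) := by
  ext a c
  rw [embed_mul_apply hp]
  simp only [embedGate, upd_fst hp, upd_snd]
  have : ∀ x y, (∀ i, i ≠ p.1 → i ≠ p.2 → upd p a x y i = c i) ↔
      (∀ i, i ≠ p.1 → i ≠ p.2 → a i = c i) := by
    intro x y
    refine forall_congr' fun i => ?_
    refine forall_congr' fun h1 => ?_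
    refine forall_congr' fun h2 => ?_
    rw [upd_other _ _ _ h1 h2]
  simp only [this]
  split_ifs with h
  · rw [Matrix.mul_apply, sum_pair]
  · simp

lemma embed_one {p : Fin n × Fin n} : embedGate p (1 : M4) = (1 : NMatrix n) := by
  ext a c
  simp only [embedGate, Matrix.one_apply]
  by_cases h : a = c
  · simp [h]
  · rw [if_neg h]
    split_ifs with h1 h2
    · exfalso
      apply h
      obtain ⟨h3, h4⟩ := pairIdx_inj h2
      funext i
      by_cases e1 : i = p.1
      · rw [e1, h3]
      by_cases e2 : i = p.2
      · rw [e2, h4]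
      exact h1 i e1 e2
    · rfl
    · rfl

lemma embed_transpose {p : Fin n × Fin n} (u : M4) :
    (embedGate p u)ᵀ = embedGate p uᵀ := by
  ext a c
  simp only [embedGate, Matrix.transpose_apply, eq_comm]

/-- Tensor product of one-qubit matrices. -/
noncomputable def Loc (w : Fin n → M2) : NMatrix n := fun a b => ∏ i, w i (a i) (b i)

lemma Loc_one : Loc (fun _ : Fin n => (1 : M2)) = 1 := by
  ext a b
  simp only [Loc, Matrix.one_apply]
  by_cases h : a = b
  · simp [h]
  · rw [if_neg h]
    obtain ⟨i, hi⟩ := Function.ne_iff.mp h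
    exact Finset.prod_eq_zero (Finset.mem_univ i) (by simp [hi])

lemma Loc_mul (w w' : Fin n → M2) : Loc w * Loc w' = Loc (fun i => w i * w' i) := by
  ext a b
  simp only [Loc, Matrix.mul_apply]
  rw [Finset.prod_univ_sum, Fintype.piFinset_univ]
  simp [Finset.prod_mul_distrib]

lemma Loc_trace (w : Fin n → M2) : (Loc w).trace = ∏ i, (w i).trace := by
  simp only [Loc, Matrix.trace, Matrix.diag]
  rw [Finset.prod_univ_sum, Fintype.piFinset_univ]

lemma Loc_transpose (w : Fin n → M2) : (Loc w)ᵀ = Loc (fun i => (w i)ᵀ) := by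
  ext a b
  simp [Loc]

lemma prod_split {p : Fin n × Fin n} (hp : p.1 ≠ p.2) (f : Fin n → ℂ) :
    ∏ i, f i = f p.1 * f p.2 * ∏ i ∈ (Finset.univ.erase p.1).erase p.2, f i := by
  rw [← Finset.mul_prod_erase Finset.univ f (Finset.mem_univ p.1),
    ← Finset.mul_prod_erase (Finset.univ.erase p.1) f
      (Finset.mem_erase.mpr ⟨hp.symm, Finset.mem_univ _⟩), mul_assoc]

lemma embed_mul_Loc {p : Fin n × Fin n} (hp : p.1 ≠ p.2) (u : M4) (w : Fin n → M2)
    (h1 : w p.1 = 1) (h2 : w p.2 = 1) (a c : QubitBasis n) :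
    (embedGate p u * Loc w) a c = u (pairIdx (a p.1) (a p.2)) (pairIdx (c p.1) (c p.2)) *
      ∏ i ∈ (Finset.univ.erase p.1).erase p.2, w i (a i) (c i) := by
  rw [embed_mul_apply hp]
  have : ∀ x y, Loc w (upd p a x y) c = (1 : M2) x (c p.1) * (1 : M2) y (c p.2) *
      ∏ i ∈ (Finset.univ.erase p.1).erase p.2, w i (a i) (c i) := by
    intro x y
    rw [Loc, prod_split hp, upd_fst hp, upd_snd, h1, h2]
    congr 1
    refine Finset.prod_congr rfl fun i hi => ?_
    simp only [Finset.mem_erase, Finset.mem_univ, and_true] at hi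
    rw [upd_other _ _ _ hi.2 hi.1]
  simp only [this]
  rw [Finset.sum_eq_single (c p.1), Finset.sum_eq_single (c p.2)]
  · simp
  · intro b _ hb; simp [Matrix.one_apply, hb]
  · simp
  · intro b _ hb; simp [Matrix.one_apply, hb]
  · simp

lemma Loc_comm {p : Fin n × Fin n} (hp : p.1 ≠ p.2) (u : M4) (w : Fin n → M2)
    (h1 : w p.1 = 1) (h2 : w p.2 = 1) : Loc w * embedGate p u = embedGate p u * Loc w := by
  apply Matrix.transpose_injective
  rw [Matrix.transpose_mul, embed_transpose, Loc_transpose]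
  ext a c
  rw [embed_mul_Loc hp _ _ (by simp [h1]) (by simp [h2])]
  simp only [Matrix.transpose_apply]
  rw [embed_mul_Loc hp _ _ h1 h2]

/-- Set the two tensor factors of `p` to given values. -/
noncomputable def setp (p : Fin n × Fin n) (w : Fin n → M2) (x y : M2) : Fin n → M2 :=
  Function.update (Function.update w p.1 x) p.2 y

lemma setp_fst {p : Fin n × Fin n} (hp : p.1 ≠ p.2) (w : Fin n → M2) (x y : M2) :
    setp p w x y p.1 = x := by simp [setp, hp]

lemma setp_snd {p : Fin n × Fin n} (w : Fin n → M2) (x y : M2) :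
    setp p w x y p.2 = y := by simp [setp]

lemma setp_other {p : Fin n × Fin n} (w : Fin n → M2) (x y : M2) {i : Fin n}
    (h1 : i ≠ p.1) (h2 : i ≠ p.2) : setp p w x y i = w i := by simp [setp, h1, h2]

lemma embed_kron_Loc {p : Fin n × Fin n} (hp : p.1 ≠ p.2) (w : Fin n → M2) (x y : M2) :
    embedGate p (kron2 x y) * Loc (setp p w 1 1) = Loc (setp p w x y) := by
  ext a c
  rw [embed_mul_Loc hp _ _ (setp_fst hp ..) (setp_snd ..), Loc, prod_split hp, kron2_apply,
    setp_fst hp, setp_snd]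
  congr 1
  refine Finset.prod_congr rfl fun i hi => ?_
  simp only [Finset.mem_erase, Finset.mem_univ, and_true] at hi
  rw [setp_other _ _ _ hi.2 hi.1, setp_other _ _ _ hi.2 hi.1]

lemma setp_self {p : Fin n × Fin n} (w : Fin n → M2) : setp p w (w p.1) (w p.2) = w := by
  simp [setp]

end RA

namespace RA

abbrev SU2 := Matrix.specialUnitaryGroup (Fin 2) ℂ

noncomputable def ee (x : ℝ) : ℂ := Complex.exp (x * Complex.I)

lemma ee_add (x y : ℝ) : ee (x + y) = ee x * ee y := by
  simp [ee, add_mul, Complex.exp_add]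

lemma ee_zero : ee 0 = 1 := by simp [ee]

lemma ee_neg_mul (x : ℝ) : ee (-x) * ee x = 1 := by
  rw [← ee_add]; simp [ee_zero]

lemma ee_mul_neg (x : ℝ) : ee x * ee (-x) = 1 := by
  rw [← ee_add]; simp [ee_zero]

lemma ee_star (x : ℝ) : star (ee x) = ee (-x) := by
  simp [ee, ← Complex.exp_conj]

lemma ee_conj (x : ℝ) : (starRingEnd ℂ) (ee x) = ee (-x) := ee_star x

lemma ee_norm (x : ℝ) : ‖ee x‖ = 1 := by simp [ee, Complex.norm_exp_ofReal_mul_I]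

lemma polar (z : ℂ) : ∃ x : ℝ, z = ‖z‖ * ee x :=
  ⟨z.arg, (Complex.norm_mul_exp_arg_mul_I z).symm⟩

lemma polar_unit {z : ℂ} (h : ‖z‖ = 1) : ∃ x : ℝ, z = ee x := by
  obtain ⟨x, hx⟩ := polar z
  exact ⟨x, by rw [hx, h]; simp⟩

lemma circ {p q : ℝ} (h : p ^ 2 + q ^ 2 = 1) : ∃ x : ℝ, Real.cos x = p ∧ Real.sin x = q := by
  have hn : ‖(⟨p, q⟩ : ℂ)‖ = 1 := by
    rw [Complex.norm_def, Complex.normSq_mk, Real.sqrt_eq_one]; nlinarith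
  obtain ⟨x, hx⟩ := polar_unit hn
  refine ⟨x, ?_, ?_⟩
  · have := congrArg Complex.re hx
    simpa [ee, Complex.exp_ofReal_mul_I_re] using this.symm
  · have := congrArg Complex.im hx
    simpa [ee, Complex.exp_ofReal_mul_I_im] using this.symm

lemma sphere {p q r : ℝ} (h : p ^ 2 + q ^ 2 + r ^ 2 = 1) : ∃ x y : ℝ, Real.cos x = p ∧
    Real.sin x * Real.cos y = q ∧ Real.sin x * Real.sin y = r := by
  have hs : Real.sqrt (q ^ 2 + r ^ 2) ^ 2 = q ^ 2 + r ^ 2 := Real.sq_sqrt (by positivity)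
  obtain ⟨x, hx1, hx2⟩ := circ (p := p) (q := Real.sqrt (q ^ 2 + r ^ 2)) (by rw [hs]; linarith)
  by_cases h0 : Real.sqrt (q ^ 2 + r ^ 2) = 0
  · refine ⟨x, 0, hx1, ?_, ?_⟩
    · rw [h0] at hx2 hs
      rw [hx2]; nlinarith [sq_nonneg q, sq_nonneg r]
    · rw [h0] at hx2 hs
      rw [hx2]; nlinarith [sq_nonneg q, sq_nonneg r]
  · obtain ⟨y, hy1, hy2⟩ := circ (p := q / Real.sqrt (q ^ 2 + r ^ 2))
      (q := r / Real.sqrt (q ^ 2 + r ^ 2)) (by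
        rw [div_pow, div_pow, ← add_div, hs]; exact div_self (by rw [← hs]; exact pow_ne_zero 2 h0))
    refine ⟨x, y, hx1, ?_, ?_⟩
    · rw [hx2, hy1]; field_simp
    · rw [hx2, hy2]; field_simp

lemma mem_SU {k : ℕ} {x : Matrix (Fin k) (Fin k) ℂ} (h1 : x * xᴴ = 1) (h2 : x.det = 1) :
    x ∈ Matrix.specialUnitaryGroup (Fin k) ℂ :=
  Matrix.mem_specialUnitaryGroup_iff.mpr ⟨Matrix.mem_unitaryGroup_iff.mpr h1, h2⟩

lemma SU_mul_ct {k : ℕ} {x : Matrix (Fin k) (Fin k) ℂ}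
    (h : x ∈ Matrix.specialUnitaryGroup (Fin k) ℂ) : x * xᴴ = 1 :=
  Matrix.mem_unitaryGroup_iff.mp (Matrix.mem_specialUnitaryGroup_iff.mp h).1

lemma SU_ct_mul {k : ℕ} {x : Matrix (Fin k) (Fin k) ℂ}
    (h : x ∈ Matrix.specialUnitaryGroup (Fin k) ℂ) : xᴴ * x = 1 :=
  Matrix.mem_unitaryGroup_iff'.mp (Matrix.mem_specialUnitaryGroup_iff.mp h).1

lemma SU_det {k : ℕ} {x : Matrix (Fin k) (Fin k) ℂ}
    (h : x ∈ Matrix.specialUnitaryGroup (Fin k) ℂ) : x.det = 1 :=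
  (Matrix.mem_specialUnitaryGroup_iff.mp h).2

lemma SU_ct {k : ℕ} {x : Matrix (Fin k) (Fin k) ℂ}
    (h : x ∈ Matrix.specialUnitaryGroup (Fin k) ℂ) :
    xᴴ ∈ Matrix.specialUnitaryGroup (Fin k) ℂ :=
  mem_SU (by rw [Matrix.conjTranspose_conjTranspose]; exact SU_ct_mul h)
    (by rw [Matrix.det_conjTranspose, SU_det h]; simp)

lemma SU_tr {k : ℕ} {x : Matrix (Fin k) (Fin k) ℂ}
    (h : x ∈ Matrix.specialUnitaryGroup (Fin k) ℂ) :
    xᵀ ∈ Matrix.specialUnitaryGroup (Fin k) ℂ := by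
  refine mem_SU ?_ (by rw [Matrix.det_transpose, SU_det h])
  have := congrArg Matrix.transpose (SU_ct_mul h)
  rw [Matrix.transpose_mul, Matrix.transpose_one] at this
  rw [← this]; rfl

lemma kron2_mem {a b : M2} (ha : a ∈ SU2) (hb : b ∈ SU2) : kron2 a b ∈ SU4 := by
  refine mem_SU ?_ ?_
  · rw [kron2_conjTranspose, kron2_mul, SU_mul_ct ha, SU_mul_ct hb, kron2_one]
  · rw [kron2_det, SU_det ha, SU_det hb]; simp

/-- Three-parameter family of one-qubit gates. -/
noncomputable def su2 (a b c : ℝ) : M2 :=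
  !![ee a * (Real.cos c : ℝ), ee b * (Real.sin c : ℝ);
    -(ee (-b) * (Real.sin c : ℝ)), ee (-a) * (Real.cos c : ℝ)]

lemma cs (c : ℝ) : ((Real.cos c : ℝ) : ℂ) ^ 2 + ((Real.sin c : ℝ) : ℂ) ^ 2 = 1 := by
  have := Real.cos_sq_add_sin_sq c
  exact_mod_cast this

lemma su2_mem (a b c : ℝ) : su2 a b c ∈ SU2 := by
  have h1 := ee_neg_mul a
  have h2 := ee_neg_mul b
  have h3 := cs c
  refine mem_SU ?_ ?_
  · ext i j
    fin_cases i <;> fin_cases j <;>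
      simp [su2, Matrix.mul_apply, ee_conj, -Complex.ofReal_cos, -Complex.ofReal_sin] <;> grind
  · simp [su2, Matrix.det_fin_two, -Complex.ofReal_cos, -Complex.ofReal_sin]; grind

lemma su2_surj {x : M2} (hx : x ∈ SU2) : ∃ a b c : ℝ, x = su2 a b c := by
  have hu := SU_mul_ct hx
  have hu2 := SU_ct_mul hx
  have hd := SU_det hx
  rw [Matrix.det_fin_two] at hd
  have hadj : x.adjugate = xᴴ := by
    have h1 := Matrix.adjugate_mul x
    rw [SU_det hx, one_smul] at h1
    calc x.adjugate = x.adjugate * (x * xᴴ) := by rw [hu, mul_one]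
      _ = xᴴ := by rw [← mul_assoc, h1, one_mul]
  rw [Matrix.adjugate_fin_two] at hadj
  have e10 := congrFun (congrFun hadj 1) 0
  have e00 := congrFun (congrFun hadj 0) 0
  simp at e10 e00
  have e01 : x 1 0 = - (starRingEnd ℂ) (x 0 1) := by rw [← e10]; ring
  obtain ⟨a, ha⟩ := polar (x 0 0)
  obtain ⟨b, hb⟩ := polar (x 0 1)
  have hn : ‖x 0 0‖ ^ 2 + ‖x 0 1‖ ^ 2 = 1 := by
    have := congrFun (congrFun hu 0) 0
    simp [Matrix.mul_apply, Complex.mul_conj'] at this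
    exact_mod_cast this
  obtain ⟨c, hc1, hc2⟩ := circ hn
  refine ⟨a, b, c, ?_⟩
  have a0 : x 0 0 = ee a * (‖x 0 0‖ : ℝ) := by rw [mul_comm]; exact ha
  have b0 : x 0 1 = ee b * (‖x 0 1‖ : ℝ) := by rw [mul_comm]; exact hb
  have a1 : (starRingEnd ℂ) (x 0 0) = ee (-a) * (‖x 0 0‖ : ℝ) := by
    conv_lhs => rw [a0]
    rw [map_mul, ee_conj, Complex.conj_ofReal]
  have b1 : (starRingEnd ℂ) (x 0 1) = ee (-b) * (‖x 0 1‖ : ℝ) := by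
    conv_lhs => rw [b0]
    rw [map_mul, ee_conj, Complex.conj_ofReal]
  ext i j
  rw [su2, hc1, hc2]
  fin_cases i <;> fin_cases j
  · simpa using a0
  · simpa using b0
  · simp only [Fin.mk_one, Fin.zero_eta, Matrix.of_apply, Matrix.cons_val]
    rw [e01, b1]
  · simp only [Fin.mk_one, Fin.zero_eta, Matrix.of_apply, Matrix.cons_val]
    rw [e00, a1]

noncomputable def rot (c : ℝ) : M2 := su2 0 0 c

/-- two-level embeddings -/
def S23 (x : M2) : M4 := !![1,0,0,0; 0,1,0,0; 0,0,x 0 0,x 0 1; 0,0,x 1 0,x 1 1]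
def S12 (x : M2) : M4 := !![1,0,0,0; 0,x 0 0,x 0 1,0; 0,x 1 0,x 1 1,0; 0,0,0,1]
def S03 (x : M2) : M4 := !![x 0 0,0,0,x 0 1; 0,1,0,0; 0,0,1,0; x 1 0,0,0,x 1 1]
def Dg (a b c d : ℂ) : M4 := !![a,0,0,0; 0,b,0,0; 0,0,c,0; 0,0,0,d]

lemma ct2 {x : M2} (hx : x * xᴴ = 1) :
    (x 0 0 * star (x 0 0) + x 0 1 * star (x 0 1) = 1) ∧
    (x 0 0 * star (x 1 0) + x 0 1 * star (x 1 1) = 0) ∧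
    (x 1 0 * star (x 0 0) + x 1 1 * star (x 0 1) = 0) ∧
    (x 1 0 * star (x 1 0) + x 1 1 * star (x 1 1) = 1) := by
  have h00 := congrFun (congrFun hx 0) 0
  have h01 := congrFun (congrFun hx 0) 1
  have h10 := congrFun (congrFun hx 1) 0
  have h11 := congrFun (congrFun hx 1) 1
  simp only [Matrix.mul_apply, Fin.sum_univ_two, Matrix.conjTranspose_apply, Matrix.one_apply] at h00 h01 h10 h11
  simpa using ⟨h00, h01, h10, h11⟩

lemma S23_u {x : M2} (hx : x * xᴴ = 1) : S23 x * (S23 x)ᴴ = 1 := by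
  obtain ⟨h1, h2, h3, h4⟩ := ct2 hx
  ext i j
  fin_cases i <;> fin_cases j <;> simp [S23, Matrix.mul_apply, Fin.sum_univ_four] <;> assumption
lemma S12_u {x : M2} (hx : x * xᴴ = 1) : S12 x * (S12 x)ᴴ = 1 := by
  obtain ⟨h1, h2, h3, h4⟩ := ct2 hx
  ext i j
  fin_cases i <;> fin_cases j <;> simp [S12, Matrix.mul_apply, Fin.sum_univ_four] <;> assumption
lemma S03_u {x : M2} (hx : x * xᴴ = 1) : S03 x * (S03 x)ᴴ = 1 := by
  obtain ⟨h1, h2, h3, h4⟩ := ct2 hx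
  ext i j
  fin_cases i <;> fin_cases j <;> simp [S03, Matrix.mul_apply, Fin.sum_univ_four] <;> assumption
lemma Dg_u (a b c d : ℝ) :
    Dg (ee a) (ee b) (ee c) (ee d) * (Dg (ee a) (ee b) (ee c) (ee d))ᴴ = 1 := by
  ext i j
  fin_cases i <;> fin_cases j <;>
    simp [Dg, Matrix.mul_apply, Fin.sum_univ_four, ee_conj, ee_mul_neg]

lemma S23_det (x : M2) : (S23 x).det = x.det := by
  rw [Matrix.det_fin_two]
  simp [S23, Matrix.det_succ_row_zero, Fin.sum_univ_succ, Fin.succAbove]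
  try ring
lemma S12_det (x : M2) : (S12 x).det = x.det := by
  rw [Matrix.det_fin_two]
  simp [S12, Matrix.det_succ_row_zero, Fin.sum_univ_succ, Fin.succAbove]
  try ring
lemma S03_det (x : M2) : (S03 x).det = x.det := by
  rw [Matrix.det_fin_two]
  simp [S03, Matrix.det_succ_row_zero, Fin.sum_univ_succ, Fin.succAbove]
  try ring
lemma Dg_det (a b c d : ℂ) : (Dg a b c d).det = a * b * c * d := by
  simp [Dg, Matrix.det_succ_row_zero, Fin.sum_univ_succ, Fin.succAbove]
  try ring

lemma S23_mem {x : M2} (hx : x ∈ SU2) : S23 x ∈ SU4 :=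
  mem_SU (S23_u (SU_mul_ct hx)) (by rw [S23_det, SU_det hx])
lemma S12_mem {x : M2} (hx : x ∈ SU2) : S12 x ∈ SU4 :=
  mem_SU (S12_u (SU_mul_ct hx)) (by rw [S12_det, SU_det hx])
lemma S03_mem {x : M2} (hx : x ∈ SU2) : S03 x ∈ SU4 :=
  mem_SU (S03_u (SU_mul_ct hx)) (by rw [S03_det, SU_det hx])
lemma Dg_mem {a b c d : ℝ} (h : a + b + c + d = 0) : Dg (ee a) (ee b) (ee c) (ee d) ∈ SU4 :=
  mem_SU (Dg_u a b c d) (by rw [Dg_det, ← ee_add, ← ee_add, ← ee_add, h, ee_zero])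

/-- Nine-parameter family of two-qubit gates, a section of `SU(4) / (SU(2) × SU(2))`. -/
noncomputable def vv (t : Fin 9 → ℝ) : M4 :=
  Dg (ee (-(t 0 + (t 4 + t 4 + t 5)))) (ee 0) (ee (t 0)) (ee 0) * S23 (su2 (t 1) (t 2) (t 3)) *
    (S12 (rot (t 6)) * S23 (rot (t 7)) * Dg (ee 0) (ee (t 4)) (ee (t 4)) (ee (t 5)) *
      S03 (rot (t 8)))

end RA

namespace RA

lemma vv_mem (t : Fin 9 → ℝ) : vv t ∈ SU4 := by
  have key : ∀ {x y : M4}, x * xᴴ = 1 → y * yᴴ = 1 → (x * y) * (x * y)ᴴ = 1 := by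
    intro x y hx hy
    rw [Matrix.conjTranspose_mul, mul_assoc, ← mul_assoc y, hy, one_mul, hx]
  refine mem_SU ?_ ?_
  · exact key (key (Dg_u _ _ _ _) (S23_u (SU_mul_ct (su2_mem _ _ _))))
      (key (key (key (S12_u (SU_mul_ct (su2_mem _ _ _))) (S23_u (SU_mul_ct (su2_mem _ _ _))))
        (Dg_u _ _ _ _)) (S03_u (SU_mul_ct (su2_mem _ _ _))))
  · simp only [vv, Matrix.det_mul, S23_det, S12_det, S03_det, rot, SU_det (su2_mem _ _ _), Dg_det,
      ← ee_add, mul_one, one_mul]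
    rw [← ee_zero]; congr 1; ring

lemma d2_mem (x : ℝ) : !![ee x, 0; 0, ee (-x)] ∈ SU2 := by
  refine mem_SU ?_ ?_
  · ext i j
    fin_cases i <;> fin_cases j <;>
      simp [Matrix.mul_apply, ee_conj, ee_mul_neg, ee_neg_mul]
  · simp [Matrix.det_fin_two, ee_mul_neg]

lemma q2_mem {z w : ℂ} (h : ‖z‖ ^ 2 + ‖w‖ ^ 2 = 1) :
    !![z, w; -(starRingEnd ℂ) w, (starRingEnd ℂ) z] ∈ SU2 := by
  have h1 : z * (starRingEnd ℂ) z + w * (starRingEnd ℂ) w = 1 := by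
    rw [Complex.mul_conj', Complex.mul_conj']; exact_mod_cast h
  refine mem_SU ?_ ?_
  · ext i j
    fin_cases i <;> fin_cases j <;>
      simp [Matrix.mul_apply] <;> grind
  · simp [Matrix.det_fin_two]; grind

lemma diag_right (ψ : M2) : ∃ b ∈ SU2, ((ψ * b)ᴴ * (ψ * b)) 0 1 = 0 := by
  have hH : (ψᴴ * ψ).IsHermitian := Matrix.isHermitian_conjTranspose_mul_self ψ
  set V : M2 := hH.eigenvectorUnitary.1 with hV
  have hVu : V * Vᴴ = 1 := Matrix.mem_unitaryGroup_iff.mp hH.eigenvectorUnitary.2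
  have hVu' : Vᴴ * V = 1 := Matrix.mem_unitaryGroup_iff'.mp hH.eigenvectorUnitary.2
  have hdiag : Vᴴ * (ψᴴ * ψ) * V = Matrix.diagonal ((↑) ∘ hH.eigenvalues) := by
    have := hH.spectral_theorem
    rw [Unitary.conjStarAlgAut_apply] at this
    conv_lhs => rw [this]
    change Vᴴ * (V * _ * Vᴴ) * V = _
    calc _ = (Vᴴ * V) * Matrix.diagonal ((↑) ∘ hH.eigenvalues) * (Vᴴ * V) := by
          simp only [mul_assoc]; rfl
      _ = _ := by rw [hVu', one_mul, mul_one]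
  have hdet : V.det * star V.det = 1 := by
    have := congrArg Matrix.det hVu
    rwa [Matrix.det_mul, Matrix.det_conjTranspose, Matrix.det_one] at this
  set W : M2 := !![star V.det, 0; 0, 1] with hW
  refine ⟨V * W, mem_SU ?_ ?_, ?_⟩
  · have hWW : W * Wᴴ = 1 := by
      ext i j
      have h2 : (starRingEnd ℂ) V.det * V.det = 1 := by rw [mul_comm]; exact hdet
      fin_cases i <;> fin_cases j <;> simp [hW, Matrix.mul_apply, h2]
    rw [Matrix.conjTranspose_mul, mul_assoc, ← mul_assoc W, hWW, one_mul, hVu]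
  · rw [Matrix.det_mul, hW, Matrix.det_fin_two_of]; simpa using hdet
  · have : (ψ * (V * W))ᴴ * (ψ * (V * W)) = Wᴴ * (Vᴴ * (ψᴴ * ψ) * V) * W := by
      simp only [Matrix.conjTranspose_mul, mul_assoc]
    rw [this, hdiag, hW]
    simp [Matrix.mul_apply, Matrix.diagonal]

lemma svd2 (ψ : M2) (h : ‖ψ 0 0‖ ^ 2 + ‖ψ 0 1‖ ^ 2 + ‖ψ 1 0‖ ^ 2 + ‖ψ 1 1‖ ^ 2 = 1) :
    ∃ a ∈ SU2, ∃ b ∈ SU2, ∃ φ θ : ℝ, aᵀ * ψ * b =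
      !![ee φ * (Real.cos θ : ℝ), 0; 0, ee φ * (Real.sin θ : ℝ)] := by
  obtain ⟨b, hb, hb0⟩ := diag_right ψ
  set χ := ψ * b with hχ
  have frob : ∀ x : M2, (x * xᴴ).trace =
      ((‖x 0 0‖ ^ 2 + ‖x 0 1‖ ^ 2 + ‖x 1 0‖ ^ 2 + ‖x 1 1‖ ^ 2 : ℝ) : ℂ) := by
    intro x
    simp [Matrix.trace_fin_two, Matrix.mul_apply, Complex.mul_conj']
    ring
  have hn : ‖χ 0 0‖ ^ 2 + ‖χ 0 1‖ ^ 2 + ‖χ 1 0‖ ^ 2 + ‖χ 1 1‖ ^ 2 = 1 := by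
    have e1 := frob χ
    rw [hχ, Matrix.conjTranspose_mul, mul_assoc, ← mul_assoc b, SU_mul_ct hb, one_mul, frob ψ, h] at e1
    exact_mod_cast e1.symm
  have ho : (starRingEnd ℂ) (χ 0 0) * χ 0 1 + (starRingEnd ℂ) (χ 1 0) * χ 1 1 = 0 := by
    simpa [Matrix.mul_apply] using hb0
  -- it suffices to diagonalize from the left
  suffices H : ∃ a0 ∈ SU2, ∃ (N : ℝ) (w : ℂ), N ^ 2 + ‖w‖ ^ 2 = 1 ∧ a0 * χ = !![(N : ℂ), 0; 0, w] by
    obtain ⟨a0, ha0, N, w, hNw, hd⟩ := H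
    obtain ⟨θ, hc, hs⟩ := circ hNw
    obtain ⟨ω, hω⟩ := polar w
    refine ⟨(!![ee (ω / 2), 0; 0, ee (-(ω / 2))] * a0)ᵀ, SU_tr (mul_mem (d2_mem _) ha0), b, hb,
      ω / 2, θ, ?_⟩
    rw [Matrix.transpose_transpose, mul_assoc, mul_assoc, ← hχ, hd, hc, hs]
    have hh : ee (-(ω / 2)) * w = ee (ω / 2) * ‖w‖ := by
      conv_lhs => rw [hω]
      rw [show ee ω = ee (ω / 2) * ee (ω / 2) by rw [← ee_add]; congr 1; ring]
      linear_combination (‖w‖ * ee (ω / 2) : ℂ) * ee_neg_mul (ω / 2)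
    ext i j
    fin_cases i <;> fin_cases j <;> simp [Matrix.mul_apply, hh]
  by_cases hp : ‖χ 0 0‖ ^ 2 + ‖χ 1 0‖ ^ 2 = 0
  · have h0 : χ 0 0 = 0 := by
      have : ‖χ 0 0‖ ^ 2 = 0 := by nlinarith [sq_nonneg ‖χ 0 0‖, sq_nonneg ‖χ 1 0‖]
      simpa using this
    have h1 : χ 1 0 = 0 := by
      have : ‖χ 1 0‖ ^ 2 = 0 := by nlinarith [sq_nonneg ‖χ 0 0‖, sq_nonneg ‖χ 1 0‖]
      simpa using this
    have hq : ‖χ 0 1‖ ^ 2 + ‖χ 1 1‖ ^ 2 = 1 := by rw [h0, h1] at hn; simpa using hn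
    refine ⟨_, q2_mem (z := χ 1 1) (w := -χ 0 1) (by rw [norm_neg]; linarith), 0, 1, by simp, ?_⟩
    have hq' : χ 0 1 * (starRingEnd ℂ) (χ 0 1) + χ 1 1 * (starRingEnd ℂ) (χ 1 1) = 1 := by
      rw [Complex.mul_conj', Complex.mul_conj']; exact_mod_cast hq
    ext i j
    fin_cases i <;> fin_cases j <;> simp [Matrix.mul_apply, h0, h1] <;> grind
  · set N := Real.sqrt (‖χ 0 0‖ ^ 2 + ‖χ 1 0‖ ^ 2) with hN
    have hN2 : N ^ 2 = ‖χ 0 0‖ ^ 2 + ‖χ 1 0‖ ^ 2 := Real.sq_sqrt (by positivity)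
    have hN0 : N ≠ 0 := by intro h0; rw [h0] at hN2; apply hp; rw [← hN2]; simp
    have hNc : (N : ℂ) ≠ 0 := by exact_mod_cast hN0
    have hNC : (N : ℂ) ^ 2 = χ 0 0 * (starRingEnd ℂ) (χ 0 0) + χ 1 0 * (starRingEnd ℂ) (χ 1 0) := by
      rw [Complex.mul_conj', Complex.mul_conj']; exact_mod_cast hN2
    have ha0 := q2_mem (z := (starRingEnd ℂ) (χ 0 0) / N) (w := (starRingEnd ℂ) (χ 1 0) / N) (by
      rw [norm_div, norm_div, RCLike.norm_conj, RCLike.norm_conj, Complex.norm_real,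
        Real.norm_eq_abs, div_pow, div_pow, sq_abs, ← add_div, ← hN2]
      exact div_self (pow_ne_zero 2 hN0))
    have hd : !![(starRingEnd ℂ) (χ 0 0) / N, (starRingEnd ℂ) (χ 1 0) / N;
        -(starRingEnd ℂ) ((starRingEnd ℂ) (χ 1 0) / N), (starRingEnd ℂ) ((starRingEnd ℂ) (χ 0 0) / N)]
        * χ = !![(N : ℂ), 0; 0, (χ 0 0 * χ 1 1 - χ 1 0 * χ 0 1) / N] := by
      ext i j
      fin_cases i <;> fin_cases j <;> simp [Matrix.mul_apply]
      · field_simp; rw [hNC]; ring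
      · field_simp; linear_combination ho
      · field_simp; ring
      · field_simp; ring
    refine ⟨_, ha0, N, _, ?_, hd⟩
    have e1 := congrArg (fun x : M2 => (x * xᴴ).trace) hd
    beta_reduce at e1
    rw [Matrix.trace_mul_comm, Matrix.conjTranspose_mul, mul_assoc, ← mul_assoc _ _ χ, SU_ct_mul ha0,
      one_mul, Matrix.trace_mul_comm, frob, hn, frob] at e1
    have e2 : (1 : ℝ) = _ := Complex.ofReal_injective e1
    simp at e2
    rw [e2, norm_div]
    simp

end RA

namespace RA

lemma col_zero {u : M4} (hu : u ∈ Matrix.unitaryGroup (Fin 4) ℂ) {i : Fin 4} {c : ℂ} (hc : c ≠ 0)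
    (hr : ∀ j, u i j = if j = i then c else 0) {k : Fin 4} (hk : k ≠ i) : u k i = 0 := by
  have h := congrFun (congrFun (Matrix.mem_unitaryGroup_iff.mp hu) k) i
  rw [Matrix.mul_apply, Finset.sum_eq_single i] at h
  · rw [Matrix.star_apply, hr i, if_pos rfl, Matrix.one_apply, if_neg hk] at h
    have : star c ≠ 0 := by simpa using hc
    exact (mul_eq_zero.mp h).resolve_right this
  · intro j _ hj
    rw [Matrix.star_apply, hr j, if_neg hj]; simp
  · simp

lemma row_norm {u : M4} (hu : u ∈ Matrix.unitaryGroup (Fin 4) ℂ) (i : Fin 4) :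
    ‖u i 0‖ ^ 2 + ‖u i 1‖ ^ 2 + ‖u i 2‖ ^ 2 + ‖u i 3‖ ^ 2 = 1 := by
  have h := congrFun (congrFun (Matrix.mem_unitaryGroup_iff.mp hu) i) i
  simp only [Matrix.mul_apply, Fin.sum_univ_four, Matrix.star_apply, Matrix.one_apply_eq] at h
  simp only [RCLike.star_def, Complex.mul_conj'] at h
  exact_mod_cast h

lemma Dg_S03 (x : M2) (b c : ℂ) : Dg 1 b c 1 * S03 x = S03 x * Dg 1 b c 1 := by
  ext i j
  fin_cases i <;> fin_cases j <;> simp [Dg, S03, Matrix.mul_apply, Fin.sum_univ_four]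

lemma kron_diag (η : ℝ) : kron2 !![ee (η / 2), 0; 0, ee (-(η / 2))]
    !![ee (-(η / 2)), 0; 0, ee (- -(η / 2))] = Dg 1 (ee η) (ee (-η)) 1 := by
  have h1 := ee_mul_neg (η / 2)
  have h2 := ee_neg_mul (η / 2)
  have h3 : ee (η / 2) * ee (η / 2) = ee η := by rw [← ee_add]; congr 1; ring
  have h4 : ee (-(η / 2)) * ee (-(η / 2)) = ee (-η) := by rw [← ee_add]; congr 1; ring
  ext i j
  fin_cases i <;> fin_cases j <;> simp [Dg, kron2, pairEquiv, h1, h2, h3, h4]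

lemma decomp1 {u : M4} (hu : u ∈ SU4) : ∃ a ∈ SU2, ∃ b ∈ SU2, ∃ φ θ : ℝ, 
    ∀ j, (u * kron2 a b * (S03 (rot θ))ᴴ) 0 j = if j = 0 then ee φ else 0 := by
  have hr := row_norm (Matrix.mem_specialUnitaryGroup_iff.mp hu).1 0
  obtain ⟨a, ha, b, hb, φ, θ, h⟩ := svd2 (Matrix.of fun x y => u 0 (pairIdx x y)) (by
    simpa [pairIdx] using hr)
  refine ⟨a, ha, b, hb, φ, θ, ?_⟩
  have h1 : ∀ x y, (u * kron2 a b) 0 (pairIdx x y) =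
      (!![ee φ * (Real.cos θ : ℝ), 0; 0, ee φ * (Real.sin θ : ℝ)] : M2) x y := by
    intro x y
    rw [← h, Matrix.mul_apply, sum_pair]
    simp only [kron2_apply]
    simp only [Matrix.mul_apply, Fin.sum_univ_two, Matrix.transpose_apply, Matrix.of_apply]
    ring
  have r0 : (u * kron2 a b) 0 0 = ee φ * (Real.cos θ : ℝ) := (h1 0 0).trans (by simp)
  have r1 : (u * kron2 a b) 0 1 = 0 := (h1 0 1).trans (by simp)
  have r2 : (u * kron2 a b) 0 2 = 0 := (h1 1 0).trans (by simp)
  have r3 : (u * kron2 a b) 0 3 = ee φ * (Real.sin θ : ℝ) := (h1 1 1).trans (by simp)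
  intro j
  have := cs θ
  rw [Matrix.mul_apply, Fin.sum_univ_four, r0, r1, r2, r3]
  fin_cases j <;> simp [S03, rot, su2, ee_zero, -Complex.ofReal_cos, -Complex.ofReal_sin] <;> grind

lemma decomp2 {u : M4} (hu : u ∈ SU4) {φ : ℝ} (h0 : ∀ j, u 0 j = if j = 0 then ee φ else 0) :
    ∃ η ξ ζ β γ : ℝ, ∀ w : M4, w = u * Dg 1 (ee η) (ee (-η)) 1 *
      (S12 (rot β) * S23 (rot γ) * Dg (ee 0) (ee ξ) (ee ξ) (ee ζ))ᴴ → 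
      (∀ j, w 0 j = if j = 0 then ee φ else 0) ∧ (∀ j, w 1 j = if j = 1 then 1 else 0) := by
  have hU := (Matrix.mem_specialUnitaryGroup_iff.mp hu).1
  have hφ : ee φ ≠ 0 := by intro h; have := ee_norm φ; rw [h] at this; simp at this
  have h10 : u 1 0 = 0 := col_zero hU hφ h0 (by decide)
  have hr := row_norm hU 1
  rw [h10] at hr
  obtain ⟨β, γ, e1, e2, e3⟩ := sphere (p := ‖u 1 1‖) (q := ‖u 1 2‖) (r := ‖u 1 3‖) (by simpa using hr)
  obtain ⟨ξ1, hξ1⟩ := polar (u 1 1)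
  obtain ⟨ξ2, hξ2⟩ := polar (u 1 2)
  obtain ⟨ζ, hζ⟩ := polar (u 1 3)
  rw [← e1] at hξ1; rw [← e2] at hξ2; rw [← e3] at hζ
  refine ⟨(ξ2 - ξ1) / 2, (ξ1 + ξ2) / 2, ζ, β, γ, ?_⟩
  rintro w rfl
  have m1 : u 1 1 * ee ((ξ2 - ξ1) / 2) * ee (-((ξ1 + ξ2) / 2)) = (Real.cos β : ℝ) := by
    rw [hξ1, mul_assoc, mul_assoc, ← ee_add, ← ee_add,
      show ξ1 + ((ξ2 - ξ1) / 2 + -((ξ1 + ξ2) / 2)) = 0 by ring, ee_zero, mul_one]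
  have m2 : u 1 2 * ee (-((ξ2 - ξ1) / 2)) * ee (-((ξ1 + ξ2) / 2)) =
      (Real.sin β : ℝ) * (Real.cos γ : ℝ) := by
    rw [hξ2, mul_assoc, mul_assoc, ← ee_add, ← ee_add,
      show ξ2 + (-((ξ2 - ξ1) / 2) + -((ξ1 + ξ2) / 2)) = 0 by ring, ee_zero, mul_one,
      Complex.ofReal_mul]
  have m3 : u 1 3 * ee (-ζ) = (Real.sin β : ℝ) * (Real.sin γ : ℝ) := by
    rw [hζ, mul_assoc, ← ee_add, add_neg_cancel, ee_zero, mul_one, Complex.ofReal_mul]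
  set x : M4 := u * Dg 1 (ee ((ξ2 - ξ1) / 2)) (ee (-((ξ2 - ξ1) / 2))) 1 *
    (Dg (ee 0) (ee ((ξ1 + ξ2) / 2)) (ee ((ξ1 + ξ2) / 2)) (ee ζ))ᴴ with hx
  have hxw : u * Dg 1 (ee ((ξ2 - ξ1) / 2)) (ee (-((ξ2 - ξ1) / 2))) 1 *
      (S12 (rot β) * S23 (rot γ) * Dg (ee 0) (ee ((ξ1 + ξ2) / 2)) (ee ((ξ1 + ξ2) / 2)) (ee ζ))ᴴ =
      x * (S23 (rot γ))ᴴ * (S12 (rot β))ᴴ := by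
    rw [hx]; simp only [Matrix.conjTranspose_mul, mul_assoc]
  rw [hxw]
  have hxv : ∀ i j, x i j = u i j * (![1, ee ((ξ2 - ξ1) / 2), ee (-((ξ2 - ξ1) / 2)), 1] j) *
      (![1, ee (-((ξ1 + ξ2) / 2)), ee (-((ξ1 + ξ2) / 2)), ee (-ζ)] j) := by
    intro i j
    rw [hx]
    fin_cases j <;> simp [Dg, Matrix.mul_apply, Fin.sum_univ_four, ee_conj, ee_zero]
  have x0 : ∀ j, x 0 j = if j = 0 then ee φ else 0 := by
    intro j
    rw [hxv, h0]
    fin_cases j <;> simp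
  have x10 : x 1 0 = 0 := by rw [hxv, h10]; simp
  have x11 : x 1 1 = (Real.cos β : ℝ) := by rw [hxv, ← m1]; simp
  have x12 : x 1 2 = (Real.sin β : ℝ) * (Real.cos γ : ℝ) := by rw [hxv, ← m2]; simp
  have x13 : x 1 3 = (Real.sin β : ℝ) * (Real.sin γ : ℝ) := by rw [hxv, ← m3]; simp
  have cβ := cs β
  have cγ := cs γ
  constructor
  · intro j
    simp only [Matrix.mul_apply, Fin.sum_univ_four, x0]
    fin_cases j <;> simp [S12, S23, rot, su2, ee_zero, -Complex.ofReal_cos, -Complex.ofReal_sin]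
  · intro j
    simp only [Matrix.mul_apply, Fin.sum_univ_four, x10, x11, x12, x13]
    fin_cases j <;> simp [S12, S23, rot, su2, ee_zero, -Complex.ofReal_cos, -Complex.ofReal_sin] <;> grind

lemma decomp3 {w : M4} (hw : w ∈ Matrix.unitaryGroup (Fin 4) ℂ) {φ : ℝ}
    (h0 : ∀ j, w 0 j = if j = 0 then ee φ else 0) (h1 : ∀ j, w 1 j = if j = 1 then 1 else 0) :
    ∃ τ a b c : ℝ, w = Dg (ee φ) (ee 0) (ee τ) (ee 0) * S23 (su2 a b c) := by
  have hφ : ee φ ≠ 0 := by intro h; have := ee_norm φ; rw [h] at this; simp at this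
  have c20 : w 2 0 = 0 := col_zero hw hφ h0 (by decide)
  have c30 : w 3 0 = 0 := col_zero hw hφ h0 (by decide)
  have c21 : w 2 1 = 0 := col_zero hw one_ne_zero h1 (by decide)
  have c31 : w 3 1 = 0 := col_zero hw one_ne_zero h1 (by decide)
  have huu := Matrix.mem_unitaryGroup_iff.mp hw
  set Y : M2 := !![w 2 2, w 2 3; w 3 2, w 3 3] with hY
  have hYu : Y * Yᴴ = 1 := by
    have e : ∀ i j : Fin 4, (w * star w) i j = (1 : M4) i j := fun i j => by rw [huu]
    have e22 := e 2 2
    have e23 := e 2 3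
    have e32 := e 3 2
    have e33 := e 3 3
    simp [Matrix.mul_apply, Fin.sum_univ_four, c20, c30, c21, c31] at e22 e23 e32 e33
    ext i j
    fin_cases i <;> fin_cases j <;> simp [hY, Matrix.mul_apply] <;> assumption
  have hdet : Y.det * star Y.det = 1 := by
    have := congrArg Matrix.det hYu
    rwa [Matrix.det_mul, Matrix.det_conjTranspose, Matrix.det_one] at this
  have hn : ‖Y.det‖ = 1 := by
    rw [RCLike.star_def, Complex.mul_conj'] at hdet
    have h2 : ‖Y.det‖ ^ 2 = 1 := by exact_mod_cast hdet
    nlinarith [norm_nonneg Y.det]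
  obtain ⟨τ, hτ⟩ := polar_unit hn
  set Z : M2 := !![ee (-τ), 0; 0, 1] with hZ
  have hZZ : Z * Zᴴ = 1 := by
    ext i j
    fin_cases i <;> fin_cases j <;> simp [hZ, Matrix.mul_apply, ee_conj, ee_neg_mul]
  have hmem : Z * Y ∈ SU2 := by
    refine mem_SU ?_ ?_
    · rw [Matrix.conjTranspose_mul, mul_assoc, ← mul_assoc Y, hYu, one_mul, hZZ]
    · rw [Matrix.det_mul, hτ, hZ, Matrix.det_fin_two_of]; simp [ee_neg_mul]
  obtain ⟨a, b, c, habc⟩ := su2_surj hmem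
  refine ⟨τ, a, b, c, ?_⟩
  rw [← habc]
  have hm := ee_mul_neg τ
  ext i j
  fin_cases i <;> fin_cases j <;>
    simp [Dg, S23, Matrix.mul_apply, Fin.sum_univ_four, h0, h1, c20, c30, c21, c31, hZ, hY, ee_zero] <;>
    grind

lemma alg1 {U K S D G : M4} (hG : Gᴴ * G = 1) (hS : Sᴴ * S = 1) (hD : D * Dᴴ = 1) (hK : K * Kᴴ = 1)
    (hc : D * S = S * D) : U * K * Sᴴ * D * Gᴴ * (G * S) * (Dᴴ * Kᴴ) = U := by
  calc U * K * Sᴴ * D * Gᴴ * (G * S) * (Dᴴ * Kᴴ)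
      = U * K * Sᴴ * D * (Gᴴ * G) * S * (Dᴴ * Kᴴ) := by simp only [mul_assoc]
    _ = U * K * Sᴴ * (D * S) * (Dᴴ * Kᴴ) := by rw [hG, mul_one]; simp only [mul_assoc]
    _ = U * K * (Sᴴ * S) * (D * Dᴴ) * Kᴴ := by rw [hc]; simp only [mul_assoc]
    _ = U := by rw [hS, hD, mul_one, mul_one, mul_assoc, hK, mul_one]

set_option maxHeartbeats 1000000 in
theorem decomp {u : M4} (hu : u ∈ SU4) :
    ∃ t, ∃ a ∈ SU2, ∃ b ∈ SU2, u = vv t * kron2 a b := by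
  obtain ⟨a, ha, b, hb, φ, θ, h1⟩ := decomp1 hu
  have hS : S03 (rot θ) ∈ SU4 := S03_mem (su2_mem _ _ _)
  have hK : kron2 a b ∈ SU4 := kron2_mem ha hb
  have hu1 : u * kron2 a b * (S03 (rot θ))ᴴ ∈ SU4 := mul_mem (mul_mem hu hK) (SU_ct hS)
  obtain ⟨η, ξ, ζ, β, γ, h2⟩ := decomp2 hu1 h1
  obtain ⟨G, hG⟩ : ∃ G : M4, G = S12 (rot β) * S23 (rot γ) * Dg (ee 0) (ee ξ) (ee ξ) (ee ζ) := ⟨_, rfl⟩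
  obtain ⟨D, hD⟩ : ∃ D : M4, D = Dg 1 (ee η) (ee (-η)) 1 := ⟨_, rfl⟩
  rw [← hG, ← hD] at h2
  have hDm : D ∈ SU4 := by
    rw [hD, ← ee_zero]; exact Dg_mem (by ring)
  have hGu : G * Gᴴ = 1 := by
    have key : ∀ {x y : M4}, x * xᴴ = 1 → y * yᴴ = 1 → (x * y) * (x * y)ᴴ = 1 := by
      intro x y hx hy
      rw [Matrix.conjTranspose_mul, mul_assoc, ← mul_assoc y, hy, one_mul, hx]
    rw [hG]; exact key (key (S12_u (SU_mul_ct (su2_mem _ _ _))) (S23_u (SU_mul_ct (su2_mem _ _ _))))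
        (Dg_u _ _ _ _)
  have hGu' : Gᴴ * G = 1 := mul_eq_one_comm.mp hGu
  have hGdet : G.det = ee (ξ + ξ + ζ) := by
    simp only [hG, Matrix.det_mul, S23_det, S12_det, rot, SU_det (su2_mem _ _ _), Dg_det,
      ← ee_add, mul_one, one_mul]
    congr 1; ring
  obtain ⟨w, hw⟩ : ∃ w : M4, w = u * kron2 a b * (S03 (rot θ))ᴴ * D * Gᴴ := ⟨_, rfl⟩
  obtain ⟨h3, h4⟩ := h2 w hw
  have hwu : w ∈ Matrix.unitaryGroup (Fin 4) ℂ :=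
    hw ▸ mul_mem (mul_mem hu1.1 hDm.1) (Matrix.mem_unitaryGroup_iff.mpr (by
      rw [Matrix.star_eq_conjTranspose, Matrix.conjTranspose_conjTranspose, hGu']))
  obtain ⟨τ, t1, t2, t3, h5⟩ := decomp3 hwu h3 h4
  have hdet : ee φ = ee (-(τ + (ξ + ξ + ζ))) := by
    have e1 : w.det = ee (-(ξ + ξ + ζ)) := by
      rw [hw, Matrix.det_mul, Matrix.det_mul, SU_det hu1, SU_det hDm, Matrix.det_conjTranspose, hGdet,
        ee_star]; simp
    have e2 : w.det = ee φ * ee τ := by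
      rw [h5, Matrix.det_mul, S23_det, SU_det (su2_mem _ _ _), Dg_det, ee_zero]; simp
    rw [e1] at e2
    rw [neg_add, ee_add, e2, mul_comm, mul_assoc, ee_mul_neg, mul_one]
  have hDK : D = kron2 !![ee (η / 2), 0; 0, ee (-(η / 2))] !![ee (-(η / 2)), 0; 0, ee (- -(η / 2))] :=
    hD.trans (kron_diag η).symm
  refine ⟨![τ, t1, t2, t3, ξ, ζ, β, γ, θ],
    (a * !![ee (η / 2), 0; 0, ee (-(η / 2))])ᴴ, SU_ct (mul_mem ha (d2_mem _)),
    (b * !![ee (-(η / 2)), 0; 0, ee (- -(η / 2))])ᴴ, SU_ct (mul_mem hb (d2_mem _)), ?_⟩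
  have hv : vv ![τ, t1, t2, t3, ξ, ζ, β, γ, θ] = w * (G * S03 (rot θ)) := by
    rw [h5, hdet, hG]; rfl
  have hcomm : D * S03 (rot θ) = S03 (rot θ) * D := by rw [hD]; exact Dg_S03 _ _ _
  rw [hv, ← kron2_conjTranspose, ← kron2_mul, ← hDK, hw, Matrix.conjTranspose_mul]
  exact (alg1 hGu' (SU_ct_mul hS) (SU_mul_ct hDm) (SU_mul_ct hK) hcomm).symm

end RA

namespace RA

/-! ### Trigonometric polynomials -/
section Trig
variable {ι : Type} [Fintype ι]

noncomputable def chr (k : ι → ℤ) (t : ι → ℝ) : ℂ := ee (∑ j, (k j : ℝ) * t j)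

lemma chr_mul (k l : ι → ℤ) : chr k * chr l = chr (k + l) := by
  funext t
  simp only [chr, Pi.mul_apply, ← ee_add, ← Finset.sum_add_distrib, Pi.add_apply, Int.cast_add,
    add_mul]

noncomputable def idx (ι : Type) [Fintype ι] (D : ℕ) : Finset (ι → ℤ) :=
  Fintype.piFinset fun _ => Finset.Icc (-(D : ℤ)) D

noncomputable def TT (ι : Type) [Fintype ι] (D : ℕ) : Submodule ℂ ((ι → ℝ) → ℂ) :=
  Submodule.span ℂ (((idx ι D).image chr : Finset ((ι → ℝ) → ℂ)) : Set ((ι → ℝ) → ℂ))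

lemma mem_idx {D : ℕ} {k : ι → ℤ} : k ∈ idx ι D ↔ ∀ j, -(D : ℤ) ≤ k j ∧ k j ≤ D := by
  simp [idx]

lemma chr_mem {D : ℕ} {k : ι → ℤ} (h : k ∈ idx ι D) : chr k ∈ TT ι D :=
  Submodule.subset_span (by
    simp only [Finset.coe_image]
    exact ⟨k, h, rfl⟩)

instance (D : ℕ) : FiniteDimensional ℂ (TT ι D) :=
  FiniteDimensional.span_finset ℂ _

lemma TT_finrank (D : ℕ) : Module.finrank ℂ (TT ι D) ≤ (2 * D + 1) ^ Fintype.card ι := by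
  refine (finrank_span_finset_le_card _).trans (Finset.card_image_le.trans ?_)
  rw [idx, Fintype.card_piFinset]
  simp only [Int.card_Icc, Finset.prod_const, Finset.card_univ]
  apply Nat.pow_le_pow_left
  omega

lemma TT_mono {D E : ℕ} (h : D ≤ E) : TT ι D ≤ TT ι E := by
  apply Submodule.span_mono
  rw [Finset.coe_image, Finset.coe_image]
  apply Set.image_mono
  intro k hk
  rw [Finset.mem_coe, mem_idx] at hk ⊢
  intro j
  have := hk j
  omega

lemma TT_mul {D E : ℕ} {f g : (ι → ℝ) → ℂ} (hf : f ∈ TT ι D) (hg : g ∈ TT ι E) :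
    f * g ∈ TT ι (D + E) := by
  have h := Submodule.mul_mem_mul hf hg
  rw [TT, TT, Submodule.span_mul_span] at h
  refine Submodule.span_le.mpr ?_ h
  rintro _ ⟨_, hx, _, hy, rfl⟩
  rw [Finset.coe_image] at hx hy
  obtain ⟨k, hk, rfl⟩ := hx
  obtain ⟨l, hl, rfl⟩ := hy
  simp only [chr_mul]
  apply chr_mem
  rw [Finset.mem_coe, mem_idx] at hk hl
  rw [mem_idx]
  intro j
  have := hk j
  have := hl j
  simp only [Pi.add_apply]
  push_cast
  omega

lemma TT_one (D : ℕ) : (1 : (ι → ℝ) → ℂ) ∈ TT ι D := by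
  have : (1 : (ι → ℝ) → ℂ) = chr 0 := by funext t; simp [chr, ee_zero]
  rw [this]
  apply chr_mem
  rw [mem_idx]; simp

lemma TT_pow {D : ℕ} {f : (ι → ℝ) → ℂ} (hf : f ∈ TT ι D) (m : ℕ) : f ^ m ∈ TT ι (m * D) := by
  induction m with
  | zero => rw [pow_zero]; exact TT_one _
  | succ m ih => rw [pow_succ, add_mul, one_mul]; exact TT_mul ih hf

lemma TT_prod {κ : Type} (s : Finset κ) {D : ℕ} {f : κ → (ι → ℝ) → ℂ} (hf : ∀ i, f i ∈ TT ι D) :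
    ∏ i ∈ s, f i ∈ TT ι (s.card * D) := by
  induction s using Finset.induction_on with
  | empty => simpa using TT_one _
  | insert a s ha ih =>
    rw [Finset.prod_insert ha, Finset.card_insert_of_notMem ha, add_mul, one_mul, add_comm]
    exact TT_mul (hf a) ih

def IsTrig (f : (ι → ℝ) → ℂ) : Prop := ∃ D, f ∈ TT ι D

lemma IsTrig.mul {f g : (ι → ℝ) → ℂ} (hf : IsTrig f) (hg : IsTrig g) :
    IsTrig fun t => f t * g t := by
  obtain ⟨D, hD⟩ := hf
  obtain ⟨E, hE⟩ := hg
  exact ⟨_, TT_mul hD hE⟩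

lemma IsTrig.add {f g : (ι → ℝ) → ℂ} (hf : IsTrig f) (hg : IsTrig g) :
    IsTrig fun t => f t + g t := by
  obtain ⟨D, hD⟩ := hf
  obtain ⟨E, hE⟩ := hg
  exact ⟨max D E, add_mem (TT_mono (le_max_left _ _) hD) (TT_mono (le_max_right _ _) hE)⟩

lemma IsTrig.const (c : ℂ) : IsTrig fun _ : ι → ℝ => c := by
  refine ⟨0, ?_⟩
  have : (fun _ : ι → ℝ => c) = c • (1 : (ι → ℝ) → ℂ) := by funext t; simp
  rw [this]
  exact Submodule.smul_mem _ _ (TT_one _)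

lemma IsTrig.neg {f : (ι → ℝ) → ℂ} (hf : IsTrig f) : IsTrig fun t => - f t := by
  simpa using (IsTrig.const (-1)).mul hf

lemma IsTrig.sum {κ : Type*} (s : Finset κ) {f : κ → (ι → ℝ) → ℂ} (hf : ∀ i, IsTrig (f i)) :
    IsTrig fun t => ∑ i ∈ s, f i t := by
  induction s using Finset.induction_on with
  | empty => simpa using IsTrig.const 0
  | insert a s ha ih =>
    simp only [Finset.sum_insert ha]
    exact (hf a).add ih

lemma IsTrig.prod {κ : Type*} (s : Finset κ) {f : κ → (ι → ℝ) → ℂ} (hf : ∀ i, IsTrig (f i)) :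
    IsTrig fun t => ∏ i ∈ s, f i t := by
  induction s using Finset.induction_on with
  | empty => simpa using IsTrig.const 1
  | insert a s ha ih =>
    simp only [Finset.prod_insert ha]
    exact (hf a).mul ih

lemma IsTrig.ee (k : ι → ℤ) : IsTrig fun t : ι → ℝ => ee (∑ j, (k j : ℝ) * t j) := by
  refine ⟨∑ j, (k j).natAbs, chr_mem ?_⟩
  rw [mem_idx]
  intro j
  have : (k j).natAbs ≤ ∑ j, (k j).natAbs :=
    Finset.single_le_sum (f := fun j => (k j).natAbs) (fun _ _ => Nat.zero_le _) (Finset.mem_univ j)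
  omega

lemma IsTrig.conj {f : (ι → ℝ) → ℂ} (hf : IsTrig f) : IsTrig fun t => (starRingEnd ℂ) (f t) := by
  obtain ⟨D, hD⟩ := hf
  induction hD using Submodule.span_induction with
  | mem x hx =>
    rw [Finset.coe_image] at hx
    obtain ⟨k, -, rfl⟩ := hx
    simp only [chr, ee_conj]
    convert IsTrig.ee (-k) using 3
    simp
  | zero => simpa using IsTrig.const 0
  | add x y _ _ hx hy => simpa using hx.add hy
  | smul c x _ hx => simpa using (IsTrig.const _).mul hx

/-- linear integer forms -/
def IsLin (l : (ι → ℝ) → ℝ) : Prop := ∃ k : ι → ℤ, ∀ t, l t = ∑ j, (k j : ℝ) * t j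

lemma IsLin.coord (j : ι) : IsLin fun t : ι → ℝ => t j :=
  ⟨Pi.single j 1, fun t => by simp [Pi.single_apply]⟩

lemma IsLin.zero : IsLin fun _ : ι → ℝ => (0 : ℝ) := ⟨0, fun t => by simp⟩

lemma IsLin.add {l m : (ι → ℝ) → ℝ} (hl : IsLin l) (hm : IsLin m) : IsLin fun t => l t + m t := by
  obtain ⟨k, hk⟩ := hl
  obtain ⟨k', hk'⟩ := hm
  exact ⟨k + k', fun t => by simp [hk, hk', add_mul, Finset.sum_add_distrib]⟩

lemma IsLin.neg {l : (ι → ℝ) → ℝ} (hl : IsLin l) : IsLin fun t => - l t := by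
  obtain ⟨k, hk⟩ := hl
  exact ⟨-k, fun t => by simp [hk]⟩

lemma IsLin.ee {l : (ι → ℝ) → ℝ} (hl : IsLin l) : IsTrig fun t => ee (l t) := by
  obtain ⟨k, hk⟩ := hl
  simp only [hk]
  exact IsTrig.ee k

lemma IsLin.cos {l : (ι → ℝ) → ℝ} (hl : IsLin l) : IsTrig fun t => ((Real.cos (l t) : ℝ) : ℂ) := by
  convert (hl.ee.add hl.neg.ee).mul (IsTrig.const (1 / 2)) using 2 with t
  simp [RA.ee, Complex.ofReal_cos, Complex.cos]; ring

lemma IsLin.sin {l : (ι → ℝ) → ℝ} (hl : IsLin l) : IsTrig fun t => ((Real.sin (l t) : ℝ) : ℂ) := by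
  convert (hl.neg.ee.add hl.ee.neg).mul (IsTrig.const (Complex.I / 2)) using 2 with t
  simp [RA.ee, Complex.ofReal_sin, Complex.sin]; ring

/-- matrices with trigonometric entries -/
def IsTM {m : Type*} (F : (ι → ℝ) → Matrix m m ℂ) : Prop := ∀ a b, IsTrig fun t => F t a b

lemma IsTM.mul {m : Type*} [Fintype m] {F G : (ι → ℝ) → Matrix m m ℂ} (hF : IsTM F) (hG : IsTM G) :
    IsTM fun t => F t * G t := by
  intro a b
  simp only [Matrix.mul_apply]
  exact IsTrig.sum _ fun c => (hF a c).mul (hG c b)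

lemma IsTM.const {m : Type*} (M : Matrix m m ℂ) : IsTM fun _ : ι → ℝ => M :=
  fun a b => IsTrig.const _

lemma IsTM.embed {n : ℕ} (p : Fin n × Fin n) {F : (ι → ℝ) → M4} (hF : IsTM F) :
    IsTM fun t => embedGate p (F t) := by
  intro a b
  simp only [embedGate]
  split
  · exact hF _ _
  · exact IsTrig.const 0

lemma IsTM.loc {n : ℕ} {F : Fin n → (ι → ℝ) → M2} (hF : ∀ i, IsTM (F i)) :
    IsTM fun t => Loc (fun i => F i t) := by
  intro a b
  simp only [Loc]
  exact IsTrig.prod _ fun i => hF i _ _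

lemma IsTM.kron {F G : (ι → ℝ) → M2} (hF : IsTM F) (hG : IsTM G) :
    IsTM fun t => kron2 (F t) (G t) := by
  intro a b
  simp only [kron2, Matrix.submatrix_apply, Matrix.kroneckerMap_apply]
  exact (hF _ _).mul (hG _ _)

lemma IsTM.su2 {l m r : (ι → ℝ) → ℝ} (hl : IsLin l) (hm : IsLin m) (hr : IsLin r) :
    IsTM fun t => su2 (l t) (m t) (r t) := by
  intro a b
  fin_cases a <;> fin_cases b
  · exact hl.ee.mul hr.cos
  · exact hm.ee.mul hr.sin
  · exact (hm.neg.ee.mul hr.sin).neg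
  · exact hl.neg.ee.mul hr.cos

lemma IsTM.S23 {F : (ι → ℝ) → M2} (hF : IsTM F) : IsTM fun t => S23 (F t) := by
  intro a b
  fin_cases a <;> fin_cases b <;> first | exact IsTrig.const _ | exact hF _ _
lemma IsTM.S12 {F : (ι → ℝ) → M2} (hF : IsTM F) : IsTM fun t => S12 (F t) := by
  intro a b
  fin_cases a <;> fin_cases b <;> first | exact IsTrig.const _ | exact hF _ _
lemma IsTM.S03 {F : (ι → ℝ) → M2} (hF : IsTM F) : IsTM fun t => S03 (F t) := by
  intro a b
  fin_cases a <;> fin_cases b <;> first | exact IsTrig.const _ | exact hF _ _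
lemma IsTM.Dg {f g h k : (ι → ℝ) → ℂ} (hf : IsTrig f) (hg : IsTrig g) (hh : IsTrig h)
    (hk : IsTrig k) : IsTM fun t => Dg (f t) (g t) (h t) (k t) := by
  intro a b
  fin_cases a <;> fin_cases b <;> first | exact IsTrig.const _ | assumption

lemma IsTM.vv {l : Fin 9 → (ι → ℝ) → ℝ} (hl : ∀ i, IsLin (l i)) :
    IsTM fun t => vv (fun i => l i t) := by
  unfold RA.vv
  refine IsTM.mul (IsTM.mul (IsTM.Dg ?_ ?_ ?_ ?_) (IsTM.S23 (IsTM.su2 (hl 1) (hl 2) (hl 3))))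
    (IsTM.mul (IsTM.mul (IsTM.mul (IsTM.S12 (IsTM.su2 IsLin.zero IsLin.zero (hl 6)))
      (IsTM.S23 (IsTM.su2 IsLin.zero IsLin.zero (hl 7))))
      (IsTM.Dg ?_ ?_ ?_ ?_)) (IsTM.S03 (IsTM.su2 IsLin.zero IsLin.zero (hl 8))))
  · exact ((hl 0).add (((hl 4).add (hl 4)).add (hl 5))).neg.ee
  · exact IsLin.zero.ee
  · exact (hl 0).ee
  · exact IsLin.zero.ee
  · exact IsLin.zero.ee
  · exact (hl 4).ee
  · exact (hl 4).ee
  · exact (hl 5).ee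

/-- real-linear functionals of trigonometric matrices -/
lemma IsTM.lin {n : ℕ} {F : (ι → ℝ) → NMatrix n} (hF : IsTM F) (φ : NMatrix n →ₗ[ℝ] ℝ) :
    IsTrig fun t => ((φ (F t) : ℝ) : ℂ) := by
  have key : ∀ M : NMatrix n, ((φ M : ℝ) : ℂ) =
      ∑ a, ∑ b, ((M a b + (starRingEnd ℂ) (M a b)) * ((φ (Matrix.single a b 1) / 2 : ℝ) : ℂ) +
        (M a b + - (starRingEnd ℂ) (M a b)) *
          (((φ (Matrix.single a b Complex.I) / 2 : ℝ) : ℂ) * (-Complex.I))) := by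
    intro M
    have hM : M = ∑ a, ∑ b, ((M a b).re • Matrix.single a b (1 : ℂ) +
        (M a b).im • Matrix.single a b Complex.I) := by
      conv_lhs => rw [Matrix.matrix_eq_sum_single M]
      refine Finset.sum_congr rfl fun a _ => Finset.sum_congr rfl fun b _ => ?_
      rw [Matrix.smul_single, Matrix.smul_single, ← Matrix.single_add]
      congr 1
      simp
    conv_lhs => rw [hM]
    simp only [map_sum, map_add, map_smul, smul_eq_mul, Complex.ofReal_sum]
    refine Finset.sum_congr rfl fun a _ => Finset.sum_congr rfl fun b _ => ?_
    have h1 : M a b + (starRingEnd ℂ) (M a b) = ((2 * (M a b).re : ℝ) : ℂ) := Complex.add_conj _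
    have h2 : M a b + - (starRingEnd ℂ) (M a b) = ((2 * (M a b).im : ℝ) : ℂ) * Complex.I := by
      rw [← sub_eq_add_neg]; exact Complex.sub_conj _
    rw [h1, h2]
    push_cast
    have := Complex.I_mul_I
    linear_combination ((M a b).im * (φ (Matrix.single a b Complex.I) : ℂ)) * this
  simp only [key]
  exact IsTrig.sum _ fun a => IsTrig.sum _ fun b =>
    (((hF a b).add (hF a b).conj).mul (IsTrig.const _)).add
      (((hF a b).add (hF a b).conj.neg).mul (IsTrig.const _))

/-- pigeonhole: more functions than variables satisfy a polynomial relation -/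
lemma alg_dep {r : ℕ} (hr : Fintype.card ι < r) (g : Fin r → (ι → ℝ) → ℂ)
    (hg : ∀ i, IsTrig (g i)) :
    ∃ P : MvPolynomial (Fin r) ℂ, P ≠ 0 ∧ ∀ t, MvPolynomial.eval (fun i => g i t) P = 0 := by
  choose D' hD' using hg
  set D := ∑ i, D' i with hDdef
  have hD : ∀ i, g i ∈ TT ι D := fun i =>
    TT_mono (Finset.single_le_sum (f := D') (fun _ _ => Nat.zero_le _) (Finset.mem_univ i)) (hD' i)
  set d := Fintype.card ι
  set E := (2 * (D * r) + 1) ^ d + 1 with hE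
  set N := r * (E * D) with hN
  let mono : (Fin r → Fin E) → (ι → ℝ) → ℂ := fun k => ∏ i, g i ^ (k i : ℕ)
  have hmono : ∀ k, mono k ∈ TT ι N := by
    intro k
    have := TT_prod (Finset.univ : Finset (Fin r)) (D := E * D) (f := fun i => g i ^ (k i : ℕ))
      (fun i => TT_mono (Nat.mul_le_mul_right _ (k i).2.le) (TT_pow (hD i) _))
    simpa using this
  have hcard : Module.finrank ℂ (TT ι N) < Fintype.card (Fin r → Fin E) := by
    refine (TT_finrank N).trans_lt ?_
    rw [Fintype.card_fun, Fintype.card_fin, Fintype.card_fin]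
    calc (2 * N + 1) ^ d ≤ ((2 * (D * r) + 1) * E) ^ d := by
          apply Nat.pow_le_pow_left
          have : 1 ≤ E := by omega
          rw [hN]; nlinarith
      _ = (2 * (D * r) + 1) ^ d * E ^ d := mul_pow _ _ _
      _ < E * E ^ d := by
          apply Nat.mul_lt_mul_of_pos_right
          · omega
          · positivity
      _ = E ^ (d + 1) := by rw [pow_succ, mul_comm]
      _ ≤ E ^ r := Nat.pow_le_pow_right (by omega) hr
  have hdep : ¬ LinearIndependent ℂ (fun k => (⟨mono k, hmono k⟩ : TT ι N)) := fun h =>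
    absurd h.fintype_card_le_finrank (not_le.mpr hcard)
  rw [Fintype.not_linearIndependent_iff] at hdep
  obtain ⟨c, hc0, k0, hk0⟩ := hdep
  let ex : (Fin r → Fin E) → (Fin r →₀ ℕ) := fun k =>
    Finsupp.equivFunOnFinite.symm (fun i => (k i : ℕ))
  have hex : Function.Injective ex := by
    intro k l h
    have := Finsupp.equivFunOnFinite.symm.injective h
    funext i
    exact Fin.ext (congrFun this i)
  refine ⟨∑ k, MvPolynomial.monomial (ex k) (c k), ?_, ?_⟩
  · intro h
    have := congrArg (MvPolynomial.coeff (ex k0)) h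
    rw [MvPolynomial.coeff_sum, Finset.sum_eq_single k0] at this
    · simp at this; exact hk0 this
    · intro b _ hb
      rw [MvPolynomial.coeff_monomial, if_neg (fun h => hb (hex h))]
    · simp
  · intro t
    have := congrFun (congrArg Subtype.val hc0) t
    simp only [Submodule.coe_sum, Submodule.coe_smul, Finset.sum_apply, Pi.smul_apply,
      smul_eq_mul, ZeroMemClass.coe_zero, Pi.zero_apply] at this
    rw [map_sum, ← this]
    refine Finset.sum_congr rfl fun k _ => ?_
    rw [MvPolynomial.eval_monomial, Finsupp.prod_fintype _ _ (by simp)]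
    simp [mono, ex, Finset.prod_apply]

end Trig

end RA

namespace RA

lemma contract_zero {n : ℕ} (A : Architecture n 0) (x : Fin 0 → SU4) : contract A x = 1 := by
  simp [contract, gateList]

lemma contract_succ {n R : ℕ} (A : Architecture n (R + 1)) (x : Fin (R + 1) → SU4) :
    contract A x = embedGate (A (Fin.last R)).1 (x (Fin.last R) : M4) *
      contract (fun i => A i.castSucc : Architecture n R) (fun i => x i.castSucc) := by
  rw [contract, gateList, List.ofFn_succ', List.concat_eq_append, List.reverse_append]
  simp [contract, gateList]

noncomputable def vS (t : Fin 9 → ℝ) : SU4 := ⟨vv t, vv_mem t⟩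

lemma push_loc {n R : ℕ} (A : Architecture n R) : ∀ (x : Fin R → SU4) (w : Fin n → M2)
    (_ : ∀ i, w i ∈ SU2), ∃ (t : Fin R → Fin 9 → ℝ) (w' : Fin n → M2), (∀ i, w' i ∈ SU2) ∧
      Loc w * contract A x = contract A (fun i => vS (t i)) * Loc w' := by
  induction R with
  | zero =>
    intro x w hw
    exact ⟨fun i => i.elim0, w, hw, by rw [contract_zero, contract_zero, one_mul, mul_one]⟩
  | succ R ih =>
    intro x w hw
    set p := (A (Fin.last R)).1 with hpdef
    have hp : p.1 ≠ p.2 := (A (Fin.last R)).2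
    obtain ⟨s, a, ha, b, hb, hs⟩ := decomp (mul_mem (kron2_mem (hw p.1) (hw p.2)) (x (Fin.last R)).2)
    obtain ⟨t, w', hw', h⟩ := ih (fun i => A i.castSucc) (fun i => x i.castSucc) (setp p w a b) (by
      intro i
      by_cases h1 : i = p.2
      · subst h1; rw [setp_snd]; exact hb
      · by_cases h2 : i = p.1
        · subst h2; rw [setp_fst hp]; exact ha
        · rw [setp_other _ _ _ h2 h1]; exact hw i)
    refine ⟨Fin.snoc (α := fun _ => Fin 9 → ℝ) t s, w', hw', ?_⟩
    rw [contract_succ, contract_succ]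
    simp only [Fin.snoc_last, Fin.snoc_castSucc]
    rw [mul_assoc, ← h, ← mul_assoc, ← mul_assoc]
    congr 1
    have e1 : Loc w = embedGate p (kron2 (w p.1) (w p.2)) * Loc (setp p w 1 1) := by
      rw [embed_kron_Loc hp, setp_self]
    rw [← hpdef, e1, mul_assoc, Loc_comm hp _ _ (setp_fst hp ..) (setp_snd ..), ← mul_assoc,
      embed_mul hp, hs, ← embed_mul hp, mul_assoc, embed_kron_Loc hp]
    rfl

lemma IsTM.contract {ι : Type} [Fintype ι] {n R : ℕ} (A : Architecture n R) :
    ∀ {F : (ι → ℝ) → Fin R → SU4} (_ : ∀ i, IsTM fun t => (F t i : M4)),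
    IsTM fun t => contract A (F t) := by
  induction R with
  | zero => intro F _; simp only [contract_zero]; exact IsTM.const _
  | succ R ih =>
    intro F hF
    simp only [contract_succ]
    exact (IsTM.embed _ (hF _)).mul (ih _ fun i => hF _)

/-- The set of unitaries with architecture `A` is contained in the range of a trigonometric map with
`9 R + 3 n` parameters. -/
lemma upper {n R : ℕ} (A : Architecture n R) :
    ∃ Θ : (((Fin R × Fin 9) ⊕ (Fin n × Fin 3)) → ℝ) → NMatrix n, IsTM Θ ∧
      ∀ x, ∃ t, contract A x = Θ t := by
  refine ⟨fun t => contract A (fun i => vS fun j => t (Sum.inl (i, j))) *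
    Loc (fun i => su2 (t (Sum.inr (i, 0))) (t (Sum.inr (i, 1))) (t (Sum.inr (i, 2)))), ?_, ?_⟩
  · refine IsTM.mul (IsTM.contract A fun i => ?_) (IsTM.loc fun i => ?_)
    · exact IsTM.vv (l := fun j t => t (Sum.inl (i, j))) fun j => IsLin.coord _
    · exact IsTM.su2 (IsLin.coord _) (IsLin.coord _) (IsLin.coord _)
  · intro x
    obtain ⟨t, w', hw', h⟩ := push_loc A x (fun _ => 1) (fun _ => one_mem _)
    rw [Loc_one, one_mul] at h
    choose a b c habc using fun i => su2_surj (hw' i)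
    refine ⟨Sum.elim (fun p => t p.1 p.2) (fun p => ![a p.1, b p.1, c p.1] p.2), ?_⟩
    rw [h]
    congr 2
    funext i
    simpa using habc i

/-! ### Null sets -/

lemma trig_ee_succ {m : ℕ} (k : Fin (m + 1) → ℤ) :
    IsTrig fun y : Fin m → ℝ => ee (∑ j : Fin m, (k j.succ : ℝ) * y j) := by
  have := IsTrig.ee (ι := Fin m) (fun j => k j.succ)
  exact this

lemma IsTrig.slice {m : ℕ} {f : (Fin (m + 1) → ℝ) → ℂ} (hf : IsTrig f) (s : ℝ) :
    IsTrig fun y : Fin m → ℝ => f (Fin.cons s y) := by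
  obtain ⟨D, hD⟩ := hf
  induction hD using Submodule.span_induction with
  | mem x hx =>
    rw [Finset.coe_image] at hx
    obtain ⟨k, -, rfl⟩ := hx
    simp only [chr, Fin.sum_univ_succ, Fin.cons_zero, Fin.cons_succ, RA.ee_add]
    have h1 : IsTrig fun _ : Fin m → ℝ => RA.ee ((k 0 : ℝ) * s) := IsTrig.const _
    have h2 : IsTrig fun y : Fin m → ℝ => RA.ee (∑ j : Fin m, (k j.succ : ℝ) * y j) :=
      trig_ee_succ k
    exact h1.mul h2
  | zero => exact IsTrig.const 0
  | add x y _ _ hx hy => exact hx.add hy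
  | smul c x _ hx => exact (IsTrig.const c).mul hx

lemma IsTrig.analytic1 {m : ℕ} {f : (Fin (m + 1) → ℝ) → ℂ} (hf : IsTrig f) (y : Fin m → ℝ) :
    AnalyticOnNhd ℝ (fun s : ℝ => f (Fin.cons s y)) Set.univ := by
  obtain ⟨D, hD⟩ := hf
  induction hD using Submodule.span_induction with
  | mem x hx =>
    rw [Finset.coe_image] at hx
    obtain ⟨k, -, rfl⟩ := hx
    simp only [chr, Fin.sum_univ_succ, Fin.cons_zero, Fin.cons_succ, RA.ee]
    intro s _
    have h0 : AnalyticAt ℝ (fun s : ℝ => (s : ℂ)) s := Complex.ofRealCLM.analyticAt s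
    push_cast
    have h1 : AnalyticAt ℝ (fun s : ℝ => ((k 0 : ℂ) * (s : ℂ) + ∑ i : Fin m, (k i.succ : ℂ) * (y i : ℂ)) *
      Complex.I) s := ((analyticAt_const.mul h0).add analyticAt_const).mul analyticAt_const
    exact (analyticAt_cexp.restrictScalars (𝕜 := ℝ)).fun_comp h1
  | zero => exact fun s _ => analyticAt_const
  | add x y _ _ hx hy => exact hx.add hy
  | smul c x _ hx => exact (analyticOnNhd_const (v := c)).mul hx

lemma IsTrig.continuous {ι : Type} [Fintype ι] {f : (ι → ℝ) → ℂ} (hf : IsTrig f) :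
    Continuous f := by
  obtain ⟨D, hD⟩ := hf
  induction hD using Submodule.span_induction with
  | mem x hx =>
    rw [Finset.coe_image] at hx
    obtain ⟨k, -, rfl⟩ := hx
    unfold chr RA.ee
    fun_prop
  | zero => exact continuous_const
  | add x y _ _ hx hy => exact hx.add hy
  | smul c x _ hx => exact hx.const_smul c

lemma null1 {g : ℝ → ℂ} (hg : AnalyticOnNhd ℝ g Set.univ) {s : ℝ} (hs : g s ≠ 0) :
    volume {s | g s = 0} = 0 := by
  have h := hg.preimage_zero_mem_codiscrete hs
  have h2 := ae_restrict_le_codiscreteWithin (μ := (volume : Measure ℝ)) MeasurableSet.univ h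
  rw [Measure.restrict_univ, mem_ae_iff] at h2
  convert h2 using 2
  ext; simp

lemma IsTrig.null : ∀ {m : ℕ} {f : (Fin m → ℝ) → ℂ} (_ : IsTrig f) {t : Fin m → ℝ} (_ : f t ≠ 0),
    volume {t | f t = 0} = 0 := by
  intro m
  induction m with
  | zero =>
    intro f _ t ht
    convert measure_empty (μ := (volume : Measure (Fin 0 → ℝ)))
    ext s
    simp only [Set.mem_ofPred_eq, Set.mem_empty_iff_false, iff_false]
    rwa [Subsingleton.elim s t]
  | succ m ih =>
    intro f hf t ht
    have hmp := (volume_preserving_piFinSuccAbove (fun _ : Fin (m + 1) => ℝ) 0).symm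
    have hcl : MeasurableSet {t | f t = 0} := (isClosed_eq hf.continuous continuous_const).measurableSet
    rw [← hmp.measure_preimage hcl.nullMeasurableSet]
    have hm2 := hmp.measurable hcl
    rw [Measure.volume_eq_prod]
    refine Measure.measure_prod_null_of_ae_null hm2 ?_
    have ht' : f (Fin.cons (t 0) (Fin.tail t)) ≠ 0 := by rwa [Fin.cons_self_tail]
    have h1 : ∀ᵐ s : ℝ, f (Fin.cons s (Fin.tail t)) ≠ 0 := by
      have := null1 (hf.analytic1 (Fin.tail t)) ht'
      rw [ae_iff]; simpa using this
    filter_upwards [h1] with s hs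
    have := ih (hf.slice s) hs
    refine (congrArg _ ?_).trans this
    ext y
    simp [MeasurableEquiv.piFinSuccAbove, Fin.insertNthEquiv]

/-! ### Haar-null sets -/

instance : SecondCountableTopology M4 :=
  inferInstanceAs (SecondCountableTopology (Fin 4 → Fin 4 → ℂ))

instance : SecondCountableTopology SU4 :=
  TopologicalSpace.Subtype.secondCountableTopology (SU4 : Set M4)

instance : Measure.IsMulLeftInvariant haarSU4 := by unfold haarSU4; infer_instance

lemma haar_null {R m : ℕ} {f : (Fin R → SU4) → ℂ} (hf : Continuous f)
    (p : (Fin m → ℝ) → (Fin R → SU4)) (hp : Continuous p) (hps : Function.Surjective p)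
    (hT : ∀ x, IsTrig fun t => f (p t * x)) {x0 : Fin R → SU4} (hx0 : f x0 ≠ 0) :
    (Measure.pi fun _ : Fin R => haarSU4) {x | f x = 0} = 0 := by
  set μ := Measure.pi fun _ : Fin R => haarSU4 with hμ
  have hcl : IsClosed {q : (Fin R → SU4) × (Fin m → ℝ) | f (p q.2 * q.1) = 0} :=
    isClosed_eq (hf.comp ((hp.comp continuous_snd).mul continuous_fst)) continuous_const
  have h0 : (μ.prod volume) {q : (Fin R → SU4) × (Fin m → ℝ) | f (p q.2 * q.1) = 0} = 0 := by
    refine Measure.measure_prod_null_of_ae_null hcl.measurableSet ?_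
    filter_upwards with x
    obtain ⟨t, ht⟩ := hps (x0 * x⁻¹)
    exact (hT x).null (t := t) (by simpa [ht] using hx0)
  rw [← Measure.prod_swap, Measure.map_apply measurable_swap hcl.measurableSet] at h0
  have h1 := Measure.measure_ae_null_of_prod_null h0
  obtain ⟨t, ht⟩ := h1.exists
  have h2 : μ ((fun x => p t * x) ⁻¹' {x | f x = 0}) = 0 := ht
  rwa [measure_preimage_mul] at h2

/-- Surjective trigonometric parametrization of `SU(4)`. -/
noncomputable def par (t : Fin 15 → ℝ) : SU4 :=
  ⟨vv (fun i => t (Fin.castAdd 6 i)) * kron2 (su2 (t 9) (t 10) (t 11)) (su2 (t 12) (t 13) (t 14)),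
    mul_mem (vv_mem _) (kron2_mem (su2_mem ..) (su2_mem ..))⟩

lemma par_surj (u : SU4) : ∃ t, par t = u := by
  obtain ⟨t, a, ha, b, hb, h⟩ := decomp u.2
  obtain ⟨a1, a2, a3, rfl⟩ := su2_surj ha
  obtain ⟨b1, b2, b3, rfl⟩ := su2_surj hb
  refine ⟨Fin.append t ![a1, a2, a3, b1, b2, b3], Subtype.ext ?_⟩
  rw [h]
  have e : (fun i => Fin.append t ![a1, a2, a3, b1, b2, b3] (Fin.castAdd 6 i)) = t := by
    funext i; exact Fin.append_left _ _ _
  have e2 : ∀ j : Fin 6, Fin.append t ![a1, a2, a3, b1, b2, b3] (Fin.natAdd 9 j) =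
    ![a1, a2, a3, b1, b2, b3] j := fun j => Fin.append_right _ _ _
  show vv (fun i => Fin.append t ![a1, a2, a3, b1, b2, b3] (Fin.castAdd 6 i)) * _ = _
  rw [e]
  exact congrArg (vv t * ·) (congrArg₂ kron2 (congr (congr (congrArg su2 (e2 0)) (e2 1)) (e2 2))
    (congr (congr (congrArg su2 (e2 3)) (e2 4)) (e2 5)))

lemma IsTM.par {ι : Type} [Fintype ι] {l : Fin 15 → (ι → ℝ) → ℝ} (hl : ∀ i, IsLin (l i)) :
    IsTM fun t => (par (fun i => l i t) : M4) :=
  IsTM.mul (IsTM.vv (l := fun i => l (Fin.castAdd 6 i)) fun i => hl _)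
    (IsTM.kron (IsTM.su2 (hl _) (hl _) (hl _)) (IsTM.su2 (hl _) (hl _) (hl _)))

lemma IsTM.continuous {ι : Type} [Fintype ι] {m : Type*} {F : (ι → ℝ) → Matrix m m ℂ}
    (hF : IsTM F) : Continuous F :=
  continuous_pi fun a => continuous_pi fun b => (hF a b).continuous

lemma contract_continuous {n R : ℕ} (A : Architecture n R) : Continuous (contract A) := by
  induction R with
  | zero => rw [funext (contract_zero A)]; exact continuous_const
  | succ R ih =>
    rw [funext (contract_succ A)]
    refine Continuous.matrix_mul ?_ ((ih _).comp (by fun_prop))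
    refine continuous_pi fun a => continuous_pi fun b => ?_
    simp only [embedGate]
    split
    · exact (continuous_subtype_val.comp (continuous_apply (Fin.last R))).matrix_elem _ _
    · exact continuous_const

lemma IsTrig.mvpoly {ι : Type} [Fintype ι] {r : ℕ} {g : Fin r → (ι → ℝ) → ℂ}
    (hg : ∀ i, IsTrig (g i)) (P : MvPolynomial (Fin r) ℂ) :
    IsTrig fun t => MvPolynomial.eval (fun i => g i t) P := by
  induction P using MvPolynomial.induction_on with
  | C a => simpa using IsTrig.const a
  | add p q hp hq => simpa using hp.add hq
  | mul_X p i hp => simpa using hp.mul (hg i)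

/-- A polynomial in real-linear coordinates of the circuit unitary, if not identically zero on the
image of the contraction map, is nonzero for almost every choice of gates. -/
lemma contract_null {n R r : ℕ} (A : Architecture n R) (π : NMatrix n →ₗ[ℝ] (Fin r → ℝ))
    (P : MvPolynomial (Fin r) ℂ) {x0 : Fin R → SU4}
    (h0 : MvPolynomial.eval (fun i => ((π (contract A x0) i : ℝ) : ℂ)) P ≠ 0) :
    (Measure.pi fun _ : Fin R => haarSU4)
      {x | MvPolynomial.eval (fun i => ((π (contract A x) i : ℝ) : ℂ)) P = 0} = 0 := by
  have hπ : Continuous π := π.continuous_of_finiteDimensional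
  let e := Fintype.equivFin (Fin R × Fin 15)
  refine haar_null (m := Fintype.card (Fin R × Fin 15)) ?_
    (fun t i => par fun j => t (e (i, j))) ?_ ?_ ?_ h0
  · refine (MvPolynomial.continuous_eval P).comp (continuous_pi fun i => ?_)
    exact Complex.continuous_ofReal.comp
      ((continuous_apply i).comp (hπ.comp (contract_continuous A)))
  · refine continuous_pi fun i => Continuous.subtype_mk ?_ _
    exact (IsTM.par (l := fun j t => t (e (i, j))) fun j => IsLin.coord _).continuous
  · intro u
    choose t ht using fun i => par_surj (u i)
    refine ⟨fun k => t (e.symm k).1 (e.symm k).2, ?_⟩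
    funext i
    simpa using ht i
  · intro x
    refine IsTrig.mvpoly (fun i => ?_) P
    refine IsTM.lin (IsTM.contract A fun k => ?_) ((LinearMap.proj i).comp π)
    exact IsTM.mul (IsTM.par (l := fun j t => t (e (k, j))) fun j => IsLin.coord _)
      (IsTM.const (x k : M4))

end RA

namespace RA

lemma pauli_zero : pauli 0 = 1 := rfl

lemma pauli_sq (a : Fin 4) : pauli a * pauli a = 1 := by
  fin_cases a <;> ext i j <;> fin_cases i <;> fin_cases j <;> simp [pauli, Matrix.mul_apply]

lemma pauli_tr (a b : Fin 4) : (pauli a * pauli b).trace = if a = b then 2 else 0 := by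
  fin_cases a <;> fin_cases b <;>
    simp [pauli, Matrix.trace, Matrix.mul_apply, Matrix.one_apply] <;> norm_num

/-- rotation generated by a Pauli matrix -/
noncomputable def prot (c : Fin 4) (t : ℝ) : M2 :=
  Real.cos t • (1 : M2) + Real.sin t • (Complex.I • pauli c)

lemma prot_mem {c : Fin 4} (hc : c ≠ 0) (t : ℝ) : prot c t ∈ SU2 := by
  have h := cs t
  have hI := Complex.I_mul_I
  refine mem_SU ?_ ?_
  · ext i j
    fin_cases c <;> first | exact absurd rfl hc | skip
    all_goals
      fin_cases i <;> fin_cases j <;>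
      simp [prot, pauli, Matrix.mul_apply, -Complex.ofReal_cos, -Complex.ofReal_sin] <;> grind
  · rw [Matrix.det_fin_two]
    fin_cases c <;> first | exact absurd rfl hc | skip
    all_goals
      simp [prot, pauli, -Complex.ofReal_cos, -Complex.ofReal_sin]
      grind

lemma exists_half : ∃ s : ℂ, s * s = 1 / 2 ∧ (starRingEnd ℂ) s = s := by
  refine ⟨((Real.sqrt (1 / 2) : ℝ) : ℂ), ?_, Complex.conj_ofReal _⟩
  rw [← Complex.ofReal_mul, Real.mul_self_sqrt (by norm_num)]; simp

lemma pauli_conj {a : Fin 4} (ha : a ≠ 0) : ∃ v ∈ SU2, v * pauli a * vᴴ = pauli 3 := by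
  obtain ⟨s, hs, hs'⟩ := exists_half
  have hI := Complex.I_mul_I
  fin_cases a
  · exact absurd rfl ha
  · refine ⟨!![s, s; -s, s], mem_SU ?_ ?_, ?_⟩
    · ext i j
      fin_cases i <;> fin_cases j <;> simp [Matrix.mul_apply, hs'] <;> grind
    · rw [Matrix.det_fin_two_of]; grind
    · ext i j
      fin_cases i <;> fin_cases j <;> simp [Matrix.mul_apply, hs', pauli] <;> grind
  · refine ⟨!![s, -Complex.I * s; -Complex.I * s, s], mem_SU ?_ ?_, ?_⟩
    · ext i j
      fin_cases i <;> fin_cases j <;> simp [Matrix.mul_apply, hs'] <;> grind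
    · rw [Matrix.det_fin_two_of]; grind
    · ext i j
      fin_cases i <;> fin_cases j <;> simp [Matrix.mul_apply, hs', pauli] <;> grind
  · exact ⟨1, one_mem _, by simp⟩

lemma exists_omega : ∃ w : ℂ, w ^ 4 = -1 ∧ w * (starRingEnd ℂ) w = 1 := by
  refine ⟨ee (Real.pi / 4), ?_, ?_⟩
  · rw [ee, ← Complex.exp_nat_mul]
    have : ((4 : ℕ) : ℂ) * (((Real.pi / 4 : ℝ) : ℂ) * Complex.I) = Real.pi * Complex.I := by
      push_cast; ring
    rw [this, Complex.exp_pi_mul_I]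
  · rw [ee_conj, ee_mul_neg]

def swp : M4 := !![1,0,0,0; 0,0,1,0; 0,1,0,0; 0,0,0,1]
def cnt : M4 := !![1,0,0,0; 0,1,0,0; 0,0,0,1; 0,0,1,0]

lemma perm_gate {g : M4} (h1 : g * gᴴ = 1) (h2 : g.det = -1) :
    ∃ u ∈ SU4, ∀ M : M4, u * M * uᴴ = g * M * gᴴ := by
  obtain ⟨w, hw, hw'⟩ := exists_omega
  have key : ∀ M : M4, (w • g) * M * (w • g)ᴴ = g * M * gᴴ := by
    intro M
    rw [Matrix.conjTranspose_smul, Matrix.mul_smul, Matrix.smul_mul, Matrix.smul_mul, smul_smul,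
      mul_comm, RCLike.star_def, hw', one_smul]
  refine ⟨w • g, mem_SU ?_ ?_, key⟩
  · have := key 1
    rwa [mul_one, mul_one, h1] at this
  · rw [Matrix.det_smul, h2]; simp [hw]

lemma swp_u : swp * swpᴴ = 1 := by
  ext i j
  fin_cases i <;> fin_cases j <;> simp [swp, Matrix.mul_apply, Fin.sum_univ_four]
lemma cnt_u : cnt * cntᴴ = 1 := by
  ext i j
  fin_cases i <;> fin_cases j <;> simp [cnt, Matrix.mul_apply, Fin.sum_univ_four]
lemma swp_det : swp.det = -1 := by
  simp [swp, Matrix.det_succ_row_zero, Fin.sum_univ_succ, Fin.succAbove]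
lemma cnt_det : cnt.det = -1 := by
  simp [cnt, Matrix.det_succ_row_zero, Fin.sum_univ_succ, Fin.succAbove]
lemma kron2_explicit (x y : M2) : kron2 x y =
    !![x 0 0 * y 0 0, x 0 0 * y 0 1, x 0 1 * y 0 0, x 0 1 * y 0 1;
       x 0 0 * y 1 0, x 0 0 * y 1 1, x 0 1 * y 1 0, x 0 1 * y 1 1;
       x 1 0 * y 0 0, x 1 0 * y 0 1, x 1 1 * y 0 0, x 1 1 * y 0 1;
       x 1 0 * y 1 0, x 1 0 * y 1 1, x 1 1 * y 1 0, x 1 1 * y 1 1] := by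
  ext i j
  fin_cases i <;> fin_cases j <;> rfl
lemma swp_kron (x : M2) : swp * kron2 x 1 * swpᴴ = kron2 1 x := by
  rw [kron2_explicit, kron2_explicit]
  ext i j
  fin_cases i <;> fin_cases j <;>
    simp [swp, Matrix.mul_apply, Fin.sum_univ_four]
lemma cnt_kron : cnt * kron2 (pauli 3) (pauli 3) * cntᴴ = kron2 1 (pauli 3) := by
  rw [kron2_explicit, kron2_explicit]
  ext i j
  fin_cases i <;> fin_cases j <;>
    simp [cnt, Matrix.mul_apply, Fin.sum_univ_four, pauli]

lemma two_qubit (a b : Fin 4) : ∃ u ∈ SU4, ∃ c : Fin 4, (c = 0 → a = 0 ∧ b = 0) ∧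
    u * kron2 (pauli a) (pauli b) * uᴴ = kron2 1 (pauli c) := by
  by_cases ha : a = 0
  · subst ha
    exact ⟨1, one_mem _, b, fun h => ⟨rfl, h⟩, by simp [pauli_zero]⟩
  by_cases hb : b = 0
  · subst hb
    obtain ⟨u, hu, h⟩ := perm_gate swp_u swp_det
    exact ⟨u, hu, a, fun h => absurd h ha, by rw [h, pauli_zero, swp_kron]⟩
  obtain ⟨u, hu, h⟩ := perm_gate cnt_u cnt_det
  obtain ⟨v, hv, hv'⟩ := pauli_conj ha
  obtain ⟨w, hw, hw'⟩ := pauli_conj hb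
  refine ⟨u * kron2 v w, mul_mem hu (kron2_mem hv hw), 3, fun h => absurd h (by decide), ?_⟩
  have : u * kron2 v w * kron2 (pauli a) (pauli b) * (u * kron2 v w)ᴴ =
      u * (kron2 v w * kron2 (pauli a) (pauli b) * (kron2 v w)ᴴ) * uᴴ := by
    rw [Matrix.conjTranspose_mul]; simp only [mul_assoc]
  rw [this, kron2_conjTranspose, kron2_mul, kron2_mul, hv', hw', h, cnt_kron]

/-! ### Pauli strings -/
variable {n : ℕ}

noncomputable def PS (s : Fin n → Fin 4) : NMatrix n := Loc fun i => pauli (s i)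

lemma PS_tr (s s' : Fin n → Fin 4) : (PS s * PS s').trace = if s = s' then 2 ^ n else 0 := by
  rw [PS, PS, Loc_mul, Loc_trace]
  simp only [pauli_tr]
  split_ifs with h
  · subst h; simp
  · obtain ⟨i, hi⟩ := Function.ne_iff.mp h
    exact Finset.prod_eq_zero (Finset.mem_univ i) (by simp [hi])

lemma PS_indep {g g' : NMatrix n} (hg : g * g' = 1) :
    LinearIndependent ℝ (fun s : Fin n → Fin 4 => (Complex.I • PS s) * g) := by
  rw [Fintype.linearIndependent_iff]
  intro c hc s
  have h1 : (∑ s, (c s : ℂ) • PS s) = 0 := by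
    have := congrArg (fun M => (-Complex.I) • (M * g')) hc
    simp only [Finset.sum_mul, zero_mul, smul_zero, smul_mul_assoc, mul_assoc, hg, mul_one,
      Finset.smul_sum] at this
    rw [← this]
    refine Finset.sum_congr rfl fun s _ => ?_
    rw [smul_comm (-Complex.I) (c s), smul_smul]
    simp
  have h2 := congrArg (fun M => (M * PS s).trace) h1
  simp only [Finset.sum_mul, Matrix.trace_sum, smul_mul_assoc, Matrix.trace_smul, PS_tr, zero_mul,
    Matrix.trace_zero, smul_eq_mul] at h2
  simpa using h2

lemma embed_PS {p : Fin n × Fin n} (hp : p.1 ≠ p.2) (s : Fin n → Fin 4) :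
    PS s = embedGate p (kron2 (pauli (s p.1)) (pauli (s p.2))) *
      Loc (setp p (fun i => pauli (s i)) 1 1) := by
  rw [embed_kron_Loc hp, PS, setp_self (p := p) (fun i => pauli (s i))]

lemma embed_kron_one {p : Fin n × Fin n} (hp : p.1 ≠ p.2) (s : Fin n → Fin 4)
    (hs : ∀ i, i ≠ p.2 → s i = 0) : PS s = embedGate p (kron2 1 (pauli (s p.2))) := by
  rw [embed_PS hp, hs _ hp, pauli_zero]
  have : setp p (fun i => pauli (s i)) 1 1 = fun _ => 1 := by
    funext i
    by_cases h1 : i = p.2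
    · subst h1; rw [setp_snd]
    · by_cases h2 : i = p.1
      · subst h2; rw [setp_fst hp]
      · rw [setp_other _ _ _ h2 h1, hs _ h1, pauli_zero]
  rw [this, Loc_one, mul_one]

lemma conj_step {p : Fin n × Fin n} (hp : p.1 ≠ p.2) (s : Fin n → Fin 4) (hs : s ≠ 0) :
    ∃ u ∈ SU4, ∃ s' : Fin n → Fin 4, s' ≠ 0 ∧ s' p.1 = 0 ∧
      (∀ i, i ≠ p.1 → i ≠ p.2 → s' i = s i) ∧
      embedGate p u * PS s * embedGate p uᴴ = PS s' := by
  obtain ⟨u, hu, c, hc, h⟩ := two_qubit (s p.1) (s p.2)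
  have e1 : ∀ x y, Function.update (Function.update s p.1 x) p.2 y p.1 = x := by
    intro x y; simp [hp]
  have e2 : ∀ x y, Function.update (Function.update s p.1 x) p.2 y p.2 = y := by
    intro x y; simp
  have e3 : ∀ x y i, i ≠ p.1 → i ≠ p.2 → Function.update (Function.update s p.1 x) p.2 y i = s i := by
    intro x y i h1 h2; simp [h1, h2]
  refine ⟨u, hu, Function.update (Function.update s p.1 0) p.2 c, ?_, e1 _ _, e3 _ _, ?_⟩
  · intro h0
    have hc0 : c = 0 := by
      have := congrFun h0 p.2
      rwa [e2] at this
    obtain ⟨ha, hb⟩ := hc hc0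
    apply hs
    funext i
    by_cases h1 : i = p.1
    · subst h1; exact ha
    by_cases h2 : i = p.2
    · subst h2; exact hb
    have := congrFun h0 i
    rwa [e3 _ _ _ h1 h2] at this
  · have hset : setp p (fun i => pauli (Function.update (Function.update s p.1 0) p.2 c i)) 1 1 =
        setp p (fun i => pauli (s i)) 1 1 := by
      funext i
      by_cases h1 : i = p.2
      · subst h1; rw [setp_snd, setp_snd]
      · by_cases h2 : i = p.1
        · subst h2; rw [setp_fst hp, setp_fst hp]
        · rw [setp_other _ _ _ h2 h1, setp_other _ _ _ h2 h1, e3 _ _ _ h2 h1]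
    rw [embed_PS hp s, embed_PS hp (Function.update (Function.update s p.1 0) p.2 c), hset, e1, e2,
      pauli_zero, ← h, mul_assoc, mul_assoc,
      Loc_comm hp _ _ (setp_fst hp ..) (setp_snd ..), ← mul_assoc, ← mul_assoc, embed_mul hp,
      embed_mul hp]

end RA

namespace RA

attribute [local instance] Matrix.normedAddCommGroup Matrix.normedSpace

variable {n : ℕ}

/-- the set `S` contains a smooth patch of dimension at least `r` -/
def DimGE (S : Set (NMatrix n)) (r : ℕ) : Prop :=
  ∃ (E : Type) (_ : NormedAddCommGroup E) (_ : NormedSpace ℝ E) (_ : FiniteDimensional ℝ E)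
    (γ : E → NMatrix n) (D : E →L[ℝ] NMatrix n),
    r ≤ Module.finrank ℝ E ∧ (∀ t, γ t ∈ S) ∧ HasStrictFDerivAt γ D 0 ∧ Function.Injective D

lemma DimGE.mono {S S' : Set (NMatrix n)} {r r' : ℕ} (h : DimGE S r) (hr : r' ≤ r)
    (hS : ∀ U ∈ S, U ∈ S') : DimGE S' r' := by
  obtain ⟨E, i1, i2, i3, γ, D, h1, h2, h3, h4⟩ := h
  exact ⟨E, i1, i2, i3, γ, D, hr.trans h1, fun t => hS _ (h2 t), h3, h4⟩

lemma DimGE.point {S : Set (NMatrix n)} {U : NMatrix n} (h : U ∈ S) : DimGE S 0 :=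
  ⟨PUnit, inferInstance, inferInstance, inferInstance, fun _ => U, 0, Nat.zero_le _, fun _ => h,
    hasStrictFDerivAt_const _ _, fun _ _ _ => rfl⟩

lemma embed_prot {p : Fin n × Fin n} (hp : p.1 ≠ p.2) (c : Fin 4) (t : ℝ) :
    embedGate p (kron2 1 (prot c t)) = Real.cos t • (1 : NMatrix n) +
      Real.sin t • (Complex.I • embedGate p (kron2 1 (pauli c))) := by
  have h1 : (1 : NMatrix n) = embedGate p (kron2 1 1) := by rw [kron2_one, embed_one]
  rw [h1]
  ext a b
  simp only [embedGate, Matrix.add_apply, Matrix.smul_apply, kron2_apply]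
  split
  · simp only [prot, Matrix.add_apply, Matrix.smul_apply, smul_eq_mul, Complex.real_smul]; ring
  · simp

lemma DimGE.ext {S S' : Set (NMatrix n)} {r : ℕ} (h : DimGE S r)
    (hinv : ∀ U ∈ S, ∃ V, U * V = 1)
    (T : Finset (Fin n → Fin 4)) (hT : r < T.card)
    (hstep : ∀ s ∈ T, ∃ (C C' : NMatrix n) (p : Fin n × Fin n) (c : Fin 4), C' * C = 1 ∧
      p.1 ≠ p.2 ∧
      C * PS s * C' = embedGate p (kron2 1 (pauli c)) ∧
      ∀ U ∈ S, ∀ t, embedGate p (kron2 1 (prot c t)) * (C * U) ∈ S') :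
    DimGE S' (r + 1) := by
  obtain ⟨E, i1, i2, i3, γ, D, h1, h2, h3, h4⟩ := h
  by_cases hr : r + 1 ≤ Module.finrank ℝ E
  · obtain ⟨s, hs⟩ := Finset.card_pos.mp (Nat.zero_lt_of_lt hT)
    obtain ⟨C, C', p, c, hC, hp, -, hmem⟩ := hstep s hs
    have hCS : ∀ U ∈ S, C * U ∈ S' := by
      intro U hU
      have := hmem U hU 0
      rwa [embed_prot hp, Real.cos_zero, Real.sin_zero, one_smul, zero_smul, add_zero,
        one_mul] at this
    refine ⟨E, i1, i2, i3, fun e => C * γ e,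
      (LinearMap.toContinuousLinearMap (LinearMap.mulLeft ℝ C)).comp D, hr,
      fun t => hCS _ (h2 t), ?_, ?_⟩
    · exact (LinearMap.toContinuousLinearMap (LinearMap.mulLeft ℝ C)).hasStrictFDerivAt.comp 0 h3
    · intro x y hxy
      apply h4
      have : C * D x = C * D y := hxy
      have := congrArg (C' * ·) this
      simpa [← mul_assoc, hC] using this
  have hfr : Module.finrank ℝ E = r := by omega
  obtain ⟨V, hV⟩ := hinv _ (h2 0)
  have hli := PS_indep hV
  obtain ⟨s, hsT, hs⟩ : ∃ s ∈ T, (Complex.I • PS s) * γ 0 ∉ LinearMap.range D.toLinearMap := by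
    by_contra hcon
    push Not at hcon
    have hli' : LinearIndependent ℝ (fun s : T => (⟨(Complex.I • PS s.1) * γ 0, hcon _ s.2⟩ :
        LinearMap.range D.toLinearMap)) := by
      apply LinearIndependent.of_comp (LinearMap.range D.toLinearMap).subtype
      exact hli.comp (fun s : T => s.1) Subtype.val_injective
    have := hli'.fintype_card_le_finrank
    rw [LinearMap.finrank_range_of_inj h4, hfr, Fintype.card_coe] at this
    omega
  obtain ⟨C, C', p, c, hC, hp, hconj, hmem⟩ := hstep s hsT
  let L1 := LinearMap.toContinuousLinearMap (LinearMap.mulLeft ℝ C)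
  let L2 := LinearMap.toContinuousLinearMap (LinearMap.mulLeft ℝ (Complex.I • PS s))
  have hPC : embedGate p (kron2 1 (pauli c)) * C = C * PS s := by
    rw [← hconj, mul_assoc, hC, mul_one]
  refine ⟨E × ℝ, inferInstance, inferInstance, inferInstance,
    fun x => L1 (Real.cos x.2 • γ x.1 + Real.sin x.2 • L2 (γ x.1)),
    L1.comp (D.comp (ContinuousLinearMap.fst ℝ E ℝ) +
      (ContinuousLinearMap.snd ℝ E ℝ).smulRight (L2 (γ 0))), ?_, ?_, ?_, ?_⟩
  · rw [Module.finrank_prod, hfr]; simp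
  · intro x
    have := hmem _ (h2 x.1) x.2
    convert this using 1
    rw [embed_prot hp]
    change C * (Real.cos x.2 • γ x.1 + Real.sin x.2 • ((Complex.I • PS s) * γ x.1)) = _
    have h9 : embedGate p (kron2 1 (pauli c)) * (C * γ x.1) = C * (PS s * γ x.1) := by
      rw [← mul_assoc, hPC, mul_assoc]
    rw [add_mul, smul_mul_assoc, smul_mul_assoc, smul_mul_assoc, smul_mul_assoc, one_mul, h9,
      mul_add, Matrix.mul_smul, Matrix.mul_smul, Matrix.mul_smul]
  · apply L1.hasStrictFDerivAt.comp
    have hf : HasStrictFDerivAt (fun x : E × ℝ => γ x.1) (D.comp (ContinuousLinearMap.fst ℝ E ℝ)) 0 :=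
      HasStrictFDerivAt.comp (g := γ) (0 : E × ℝ) h3 hasStrictFDerivAt_fst
    have hsn : HasStrictFDerivAt (fun x : E × ℝ => x.2) (ContinuousLinearMap.snd ℝ E ℝ) 0 :=
      hasStrictFDerivAt_snd
    have hcos := (Real.hasStrictDerivAt_cos (0 : E × ℝ).2).hasStrictFDerivAt.comp (0 : E × ℝ) hsn
    have hsin := (Real.hasStrictDerivAt_sin (0 : E × ℝ).2).hasStrictFDerivAt.comp (0 : E × ℝ) hsn
    have h5 := (hcos.smul hf).add (hsin.smul (L2.hasStrictFDerivAt.comp (0 : E × ℝ) hf))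
    refine HasStrictFDerivAt.congr_fderiv h5 ?_
    apply ContinuousLinearMap.ext
    rintro ⟨e, t⟩
    change Real.cos (0 : ℝ) • D e + (t * -Real.sin (0 : ℝ)) • γ 0 +
      (Real.sin (0 : ℝ) • L2 (D e) + (t * Real.cos (0 : ℝ)) • L2 (γ 0)) = D e + t • L2 (γ 0)
    rw [Real.cos_zero, Real.sin_zero, neg_zero, mul_zero, mul_one, zero_smul, zero_smul, one_smul,
      add_zero, zero_add]
  · have hinj : ∀ x, L1 x = 0 → x = 0 := by
      intro x hx
      have : C * x = 0 := hx
      have := congrArg (C' * ·) this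
      simpa [← mul_assoc, hC] using this
    rw [injective_iff_map_eq_zero]
    rintro ⟨e, t⟩ het
    have h0 : D e + t • L2 (γ 0) = 0 := hinj _ het
    have ht : t = 0 := by
      by_contra ht
      apply hs
      refine ⟨-(t⁻¹ • e), ?_⟩
      have h6 : t • L2 (γ 0) = - D e := by rw [eq_neg_iff_add_eq_zero, add_comm]; exact h0
      have h7 : L2 (γ 0) = t⁻¹ • (- D e) := by rw [← h6, smul_smul, inv_mul_cancel₀ ht, one_smul]
      change D (-(t⁻¹ • e)) = L2 (γ 0)
      rw [h7]; simp
    subst ht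
    have h8 : D e = D 0 := by simpa using h0
    rw [h4 h8]; rfl

end RA

namespace RA

variable {n : ℕ}

/-- neighbouring pair -/
def pr (hn : 2 ≤ n) (j : Fin (n - 1)) : Fin n × Fin n :=
  (⟨j.val, by have := j.isLt; omega⟩, ⟨j.val + 1, by have := j.isLt; omega⟩)

lemma pr_ne (hn : 2 ≤ n) (j : Fin (n - 1)) : (pr hn j).1 ≠ (pr hn j).2 :=
  Fin.ne_of_val_ne (by show j.val ≠ j.val + 1; omega)

/-- reachable unitaries -/
def reach (hn : 2 ≤ n) (pos : ℕ → Fin (n - 1)) : ℕ → Set (NMatrix n)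
  | 0 => {1}
  | k + 1 => {W | ∃ u ∈ SU4, ∃ U ∈ reach hn pos k, W = embedGate (pr hn (pos k)) u * U}

lemma reach_inv (hn : 2 ≤ n) (pos : ℕ → Fin (n - 1)) (k : ℕ) :
    ∀ U ∈ reach hn pos k, ∃ V, U * V = 1 := by
  induction k with
  | zero => rintro U hU; exact ⟨1, by rw [mul_one]; exact hU⟩
  | succ k ih =>
    rintro W ⟨u, hu, U, hU, rfl⟩
    obtain ⟨V, hV⟩ := ih U hU
    refine ⟨V * embedGate (pr hn (pos k)) uᴴ, ?_⟩
    rw [mul_assoc, ← mul_assoc U, hV, one_mul, embed_mul (pr_ne hn _), SU_mul_ct hu, embed_one]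

lemma reach_contract (hn : 2 ≤ n) (pos : ℕ → Fin (n - 1)) (R : ℕ) (U : NMatrix n)
    (hU : U ∈ reach hn pos R) :
    ∃ x, contract (archOfPositions hn fun i : Fin R => pos i) x = U := by
  induction R generalizing U with
  | zero => exact ⟨fun _ => 1, by rw [contract_zero]; exact hU.symm⟩
  | succ R ih =>
    obtain ⟨u, hu, V, hV, rfl⟩ := hU
    obtain ⟨x, hx⟩ := ih V hV
    refine ⟨Fin.snoc (α := fun _ => SU4) x ⟨u, hu⟩, ?_⟩
    rw [contract_succ]
    simp only [Fin.snoc_last, Fin.snoc_castSucc]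
    rw [← hx]
    rfl

/-- multiplication by `C` can be implemented by the gates `lo..hi` -/
def Mv (hn : 2 ≤ n) (pos : ℕ → Fin (n - 1)) (lo hi : ℕ) (C : NMatrix n) : Prop :=
  ∀ U ∈ reach hn pos lo, C * U ∈ reach hn pos hi

variable {hn : 2 ≤ n} {pos : ℕ → Fin (n - 1)}

lemma Mv.trans {a b c : ℕ} {C C' : NMatrix n} (h : Mv hn pos a b C) (h' : Mv hn pos b c C') :
    Mv hn pos a c (C' * C) := by
  intro U hU
  rw [mul_assoc]
  exact h' _ (h _ hU)

lemma Mv.gate (k : ℕ) {u : M4} (hu : u ∈ SU4) : Mv hn pos k (k + 1) (embedGate (pr hn (pos k)) u) :=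
  fun U hU => ⟨u, hu, U, hU, rfl⟩

lemma Mv.id {a b : ℕ} (h : a ≤ b) : Mv hn pos a b 1 := by
  induction b, h using Nat.le_induction with
  | base => intro U hU; rwa [one_mul]
  | succ b _ ih =>
    have := ih.trans (Mv.gate (hn := hn) (pos := pos) b (one_mem SU4))
    rwa [embed_one, mul_one] at this

lemma Mv.window {a b j : ℕ} (h1 : a ≤ j) (h2 : j < b) {u : M4} (hu : u ∈ SU4) :
    Mv hn pos a b (embedGate (pr hn (pos j)) u) := by
  have := ((Mv.id h1).trans (Mv.gate (hn := hn) (pos := pos) j hu)).trans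
    (Mv.id (show j + 1 ≤ b from h2))
  rwa [mul_one, one_mul] at this

/-- a block is good if the `i`-th window contains a gate at position `i` -/
def Blk (n : ℕ) (pos : ℕ → Fin (n - 1)) (lo : ℕ) : Prop :=
  ∀ i : Fin (n - 1), ∃ j, lo + i * (n * (n - 1)) ≤ j ∧ j < lo + (i + 1) * (n * (n - 1)) ∧ pos j = i

lemma slice_stage {lo : ℕ} (hb : Blk n pos lo) (s : Fin n → Fin 4) (hs : s ≠ 0) (i : ℕ)
    (hi : i ≤ n - 1) : ∃ (C C' : NMatrix n) (s' : Fin n → Fin 4), C' * C = 1 ∧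
      C * PS s * C' = PS s' ∧ s' ≠ 0 ∧ (∀ q : Fin n, q.val < i → s' q = 0) ∧
      Mv hn pos lo (lo + i * (n * (n - 1))) C ∧
      (∀ i' : Fin (n - 1), i'.val + 1 = i → ∀ v ∈ SU4,
        Mv hn pos lo (lo + i * (n * (n - 1))) (embedGate (pr hn i') v * C)) := by
  induction i with
  | zero =>
    refine ⟨1, 1, s, one_mul _, by rw [one_mul, mul_one], hs, fun q hq => absurd hq (by omega),
      Mv.id (by omega), fun i' h => absurd h (by omega)⟩
  | succ i ih =>
    obtain ⟨C, C', s', h1, h2, h3, h4, h5, -⟩ := ih (by omega)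
    have hp := pr_ne hn ⟨i, by omega⟩
    obtain ⟨u, hu, s'', h6, h7, h8, h9⟩ := conj_step hp s' h3
    obtain ⟨j, hj1, hj2, hj3⟩ := hb ⟨i, by omega⟩
    have key : ∀ v ∈ SU4, Mv hn pos lo (lo + (i + 1) * (n * (n - 1)))
        (embedGate (pr hn ⟨i, by omega⟩) v * (embedGate (pr hn ⟨i, by omega⟩) u * C)) := by
      intro v hv
      rw [← mul_assoc (embedGate _ _) (embedGate _ _) C, embed_mul hp, ← hj3]
      exact h5.trans (Mv.window hj1 hj2 (mul_mem hv hu))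
    refine ⟨embedGate (pr hn ⟨i, by omega⟩) u * C, C' * embedGate (pr hn ⟨i, by omega⟩) uᴴ, s'',
      ?_, ?_, h6, ?_, ?_, ?_⟩
    · rw [mul_assoc, ← mul_assoc _ _ C, embed_mul hp, SU_ct_mul hu, embed_one, one_mul, h1]
    · rw [← h9, ← h2]; simp only [mul_assoc]
    · intro q hq
      by_cases hqi : q.val = i
      · have : q = (pr hn ⟨i, by omega⟩).1 := Fin.ext hqi
        rw [this, h7]
      · rw [h8 q (fun h => hqi (congrArg Fin.val h)) (fun h => ?_), h4 q (by omega)]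
        have := congrArg Fin.val h
        simp only [pr] at this
        omega
    · have := key 1 (one_mem _)
      rwa [embed_one, one_mul] at this
    · intro i' hi' v hv
      have hii : i' = ⟨i, by omega⟩ := Fin.ext (by simpa using hi')
      rw [hii]
      exact key v hv

lemma nn_pos {n : ℕ} (hn : 2 ≤ n) : 0 < (n - 1) * (n * (n - 1)) := by
  have h1 : 0 < n := by omega
  have h2 : 0 < n - 1 := by omega
  positivity

lemma card_ne_zero (n : ℕ) : (Finset.univ.erase (0 : Fin n → Fin 4)).card = 4 ^ n - 1 := by
  rw [Finset.card_erase_of_mem (Finset.mem_univ _)]; simp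

lemma block_step {lo r : ℕ} (hb : Blk n pos lo) (h : DimGE (reach hn pos lo) r)
    (hr : r < 4 ^ n - 1) : DimGE (reach hn pos (lo + (n - 1) * (n * (n - 1)))) (r + 1) := by
  refine h.ext (reach_inv hn pos lo) (Finset.univ.erase 0) (by rwa [card_ne_zero]) ?_
  intro s hs
  obtain ⟨C, C', s', h1, h2, h3, h4, -, h6⟩ :=
    slice_stage (hn := hn) hb s (Finset.ne_of_mem_erase hs) (n - 1) le_rfl
  have hp := pr_ne hn ⟨n - 2, by omega⟩
  have h7 : ∀ q, q ≠ (pr hn ⟨n - 2, by omega⟩).2 → s' q = 0 := by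
    intro q hq
    apply h4
    have : q.val ≠ n - 2 + 1 := fun h => hq (Fin.ext h)
    have := q.isLt
    omega
  refine ⟨C, C', pr hn ⟨n - 2, by omega⟩, s' (pr hn ⟨n - 2, by omega⟩).2, h1, hp,
    by rw [h2, embed_kron_one hp s' h7], ?_⟩
  intro U hU t
  rw [← mul_assoc (embedGate _ _) C U]
  refine h6 ⟨n - 2, by omega⟩ (by simp; omega) _ (kron2_mem (one_mem _) (prot_mem ?_ t)) U hU
  intro h0
  apply h3
  funext q
  by_cases hq : q = (pr hn ⟨n - 2, by omega⟩).2
  · rw [hq, h0]; rfl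
  · rw [h7 q hq]; rfl

lemma first_step {r : ℕ} (h : DimGE (reach hn pos 1) r) (hr : r < 3) :
    DimGE (reach hn pos 1) (r + 1) := by
  have hp := pr_ne hn (pos 0)
  set p := pr hn (pos 0) with hpdef
  have hinj : Function.Injective fun c : Fin 3 => Function.update (0 : Fin n → Fin 4) p.2 c.succ := by
    intro c c' h
    have := congrFun h p.2
    simpa using this
  refine h.ext (reach_inv hn pos 1)
    (Finset.univ.image fun c : Fin 3 => Function.update (0 : Fin n → Fin 4) p.2 c.succ) ?_ ?_
  · rw [Finset.card_image_of_injective _ hinj]; simpa using hr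
  · intro s hs
    obtain ⟨c, -, rfl⟩ := Finset.mem_image.mp hs
    refine ⟨1, 1, p, c.succ, one_mul _, hp, ?_, ?_⟩
    · rw [one_mul, mul_one, embed_kron_one hp]
      · simp
      · intro i hi; simp [hi]
    · rintro W ⟨u, hu, U, hU, rfl⟩ t
      refine ⟨kron2 1 (prot c.succ t) * u,
        mul_mem (kron2_mem (one_mem _) (prot_mem (Fin.succ_ne_zero c) t)) hu, U, hU, ?_⟩
      rw [one_mul, ← hpdef, ← mul_assoc, embed_mul hp]

lemma first_dim : DimGE (reach hn pos 1) 2 := by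
  have h0 : DimGE (reach hn pos 1) 0 :=
    DimGE.point (U := embedGate (pr hn (pos 0)) 1 * 1) ⟨1, one_mem _, 1, rfl, rfl⟩
  exact first_step (first_step h0 (by norm_num)) (by norm_num)

/-- number of good blocks -/
noncomputable def sc (n : ℕ) (pos : ℕ → Fin (n - 1)) (k : ℕ) : ℕ :=
  ((Finset.range k).filter fun b => Blk n pos (b * ((n - 1) * (n * (n - 1))))).card

lemma sc_le (k : ℕ) : sc n pos k ≤ k := by
  refine (Finset.card_filter_le _ _).trans (by simp)

lemma blocks_dim (hn : 2 ≤ n) (k : ℕ) :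
    DimGE (reach hn pos ((k + 1) * ((n - 1) * (n * (n - 1))))) (min (1 + sc n pos (k + 1)) (4 ^ n - 1)) := by
  have hL := nn_pos hn
  induction k with
  | zero =>
    have := sc_le (n := n) (pos := pos) (0 + 1)
    refine (first_dim (hn := hn) (pos := pos)).mono (by omega) fun U hU => ?_
    have := Mv.id (hn := hn) (pos := pos) (show 1 ≤ (0 + 1) * ((n - 1) * (n * (n - 1))) by omega) U hU
    rwa [one_mul] at this
  | succ k ih =>
    have hsplit : (k + 1 + 1) * ((n - 1) * (n * (n - 1))) =
        (k + 1) * ((n - 1) * (n * (n - 1))) + (n - 1) * (n * (n - 1)) := by ring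
    have hid : ∀ U ∈ reach hn pos ((k + 1) * ((n - 1) * (n * (n - 1)))),
        U ∈ reach hn pos ((k + 1 + 1) * ((n - 1) * (n * (n - 1)))) := by
      intro U hU
      have := Mv.id (hn := hn) (pos := pos)
        (show (k + 1) * ((n - 1) * (n * (n - 1))) ≤ (k + 1 + 1) * ((n - 1) * (n * (n - 1))) by
          rw [hsplit]; omega) U hU
      rwa [one_mul] at this
    have hsc : sc n pos (k + 1 + 1) = sc n pos (k + 1) +
        if Blk n pos ((k + 1) * ((n - 1) * (n * (n - 1)))) then 1 else 0 := by
      rw [sc, Finset.range_add_one, Finset.filter_insert]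
      split_ifs with h
      · rw [Finset.card_insert_of_notMem (by simp)]; rfl
      · rfl
    by_cases hb : Blk n pos ((k + 1) * ((n - 1) * (n * (n - 1))))
    · rw [if_pos hb] at hsc
      by_cases hr : min (1 + sc n pos (k + 1)) (4 ^ n - 1) < 4 ^ n - 1
      · have := block_step hb ih hr
        rw [← hsplit] at this
        exact this.mono (by omega) fun _ h => h
      · exact ih.mono (by omega) hid
    · rw [if_neg hb] at hsc
      exact ih.mono (by omega) hid

end RA

namespace RA

attribute [local instance] Matrix.normedAddCommGroup Matrix.normedSpace

variable {n : ℕ}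

lemma dim_null {R R' r : ℕ} (A : Architecture n R) (A' : Architecture n R')
    (h : DimGE (Set.range (contract A)) r) (hr : 9 * R' + 3 * n < r) :
    (Measure.pi fun _ : Fin R => haarSU4) {x | contract A x ∈ Set.range (contract A')} = 0 := by
  obtain ⟨E, i1, i2, i3, γ, D, h1, h2, h3, h4⟩ := h
  obtain ⟨L, hL⟩ := LinearMap.exists_leftInverse_of_injective D.toLinearMap
    (LinearMap.ker_eq_bot.mpr h4)
  let b : E ≃ₗ[ℝ] (Fin (Module.finrank ℝ E) → ℝ) := (Module.finBasis ℝ E).equivFun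
  let π : NMatrix n →ₗ[ℝ] (Fin (Module.finrank ℝ E) → ℝ) := b.toLinearMap ∘ₗ L
  obtain ⟨Θ, hΘ, hcov⟩ := upper A'
  obtain ⟨P, hP0, hP⟩ := alg_dep (r := Module.finrank ℝ E) (by simp; omega)
    (fun i t => ((π (Θ t) i : ℝ) : ℂ)) (fun i => hΘ.lin ((LinearMap.proj i) ∘ₗ π))
  have hex : ∃ x0, MvPolynomial.eval (fun i => ((π (contract A x0) i : ℝ) : ℂ)) P ≠ 0 := by
    by_contra hcon
    push Not at hcon
    apply hP0
    have hd : HasStrictFDerivAt (fun e => π (γ e))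
        ((LinearMap.toContinuousLinearMap π).comp D) 0 :=
      (LinearMap.toContinuousLinearMap π).hasStrictFDerivAt.comp 0 h3
    have hsurj : LinearMap.range ((LinearMap.toContinuousLinearMap π).comp D).toLinearMap = ⊤ := by
      rw [LinearMap.range_eq_top]
      intro y
      refine ⟨b.symm y, ?_⟩
      have h5 : L (D (b.symm y)) = b.symm y := LinearMap.congr_fun hL (b.symm y)
      change b (L (D (b.symm y))) = y
      rw [h5, LinearEquiv.apply_symm_apply]
    have hmap := hd.map_nhds_eq_of_surj hsurj
    have hnh : Set.range (fun e => π (γ e)) ∈ nhds (π (γ 0)) := by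
      rw [← hmap]; exact Filter.range_mem_map
    obtain ⟨ε, hε, hball⟩ := Metric.mem_nhds_iff.mp hnh
    refine MvPolynomial.funext_set
      (fun i => (fun x : ℝ => (x : ℂ)) '' Set.Ioo (π (γ 0) i - ε) (π (γ 0) i + ε)) ?_ ?_
    · intro i
      exact (Set.Ioo_infinite (by linarith)).image Complex.ofReal_injective.injOn
    · intro y hy
      have hy' : ∀ i, ∃ x ∈ Set.Ioo (π (γ 0) i - ε) (π (γ 0) i + ε), (x : ℂ) = y i :=
        fun i => hy i (Set.mem_univ i)
      choose x hx hxy using hy'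
      have hxb : x ∈ Metric.ball (π (γ 0)) ε := by
        rw [Metric.mem_ball, dist_pi_lt_iff hε]
        intro i
        rw [Real.dist_eq, abs_lt]
        have := hx i
        constructor <;> linarith [this.1, this.2]
      obtain ⟨e, he⟩ := hball hxb
      obtain ⟨x0, hx0⟩ := h2 e
      have := hcon x0
      have hyy : y = fun i => ((π (contract A x0) i : ℝ) : ℂ) := by
        funext i
        rw [← hxy i, hx0, ← he]
      rw [hyy, this, map_zero]
  obtain ⟨x0, hx0⟩ := hex
  refine measure_mono_null ?_ (contract_null A π P hx0)
  rintro x ⟨x', hx'⟩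
  obtain ⟨t, ht⟩ := hcov x'
  have := hP t
  change MvPolynomial.eval (fun i => ((π (contract A x) i : ℝ) : ℂ)) P = 0
  rw [← hx', ht]
  exact this

lemma cu_null {R r : ℕ} (A : Architecture n R) (h : DimGE (Set.range (contract A)) r) :
    (Measure.pi fun _ : Fin R => haarSU4) {x | 9 * Cu n (contract A x) + 3 * n < r} = 0 := by
  have : {x | 9 * Cu n (contract A x) + 3 * n < r} ⊆
      ⋃ R' ∈ {R' : ℕ | 9 * R' + 3 * n < r}, ⋃ A' : Architecture n R',
        {x | contract A x ∈ Set.range (contract A')} := by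
    intro x hx
    have hne : {R | ∃ A' : Architecture n R, ∃ x' : Fin R → SU4,
        contract A' x' = contract A x}.Nonempty := ⟨R, A, x, rfl⟩
    obtain ⟨A', x', h'⟩ := Nat.sInf_mem hne
    simp only [Set.mem_iUnion]
    exact ⟨_, hx, A', x', h'⟩
  refine measure_mono_null this ?_
  refine (measure_biUnion_null_iff (Set.to_countable _)).mpr fun R' hR' => ?_
  haveI : Finite (Architecture n R') := by unfold Architecture; infer_instance
  refine measure_iUnion_null fun A' => dim_null A A' h hR'

end RA

namespace RA

lemma unif_prob {m : ℕ} (hm : 0 < m) : IsProbabilityMeasure (uniformFin m) := by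
  constructor
  rw [uniformFin, Measure.smul_apply, smul_eq_mul, Measure.count_univ,
    ENat.card_eq_coe_fintype_card, Fintype.card_fin, ENat.toENNReal_coe]
  exact ENNReal.inv_mul_cancel (by exact_mod_cast hm.ne') (by simp)

lemma unif_compl {m : ℕ} (hm : 0 < m) (i : Fin m) :
    uniformFin m {i}ᶜ ≤ ENNReal.ofReal (Real.exp (-(1 / (m : ℝ)))) := by
  have := unif_prob hm
  rw [prob_compl_eq_one_sub (measurableSet_singleton i), uniformFin, Measure.smul_apply,
    Measure.count_singleton, smul_eq_mul, mul_one]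
  have hm' : (0 : ℝ) < m := by exact_mod_cast hm
  have h1 : ((m : ℝ≥0∞))⁻¹ = ENNReal.ofReal (1 / (m : ℝ)) := by
    rw [one_div, ENNReal.ofReal_inv_of_pos hm', ENNReal.ofReal_natCast]
  rw [h1, ← ENNReal.ofReal_one, ← ENNReal.ofReal_sub _ (by positivity)]
  refine ENNReal.ofReal_le_ofReal ?_
  have := Real.add_one_le_exp (-(1 / (m : ℝ)))
  linarith

variable {n R : ℕ}

/-- extension of the positions to all of `ℕ` -/
def extp (hn : 2 ≤ n) (pos : Fin R → Fin (n - 1)) (k : ℕ) : Fin (n - 1) :=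
  if h : k < R then pos ⟨k, h⟩ else ⟨0, by omega⟩

lemma extp_val (hn : 2 ≤ n) (pos : Fin R → Fin (n - 1)) (i : Fin R) : extp hn pos i = pos i := by
  simp [extp]

/-- distribution of the positions -/
noncomputable def mup (n R : ℕ) : Measure (Fin R → Fin (n - 1)) :=
  Measure.pi fun _ => uniformFin (n - 1)

lemma window_prob (hn : 2 ≤ n) (a M : ℕ) (ha : a + M ≤ R) (i : Fin (n - 1)) :
    mup n R {pos | ∀ j : Fin R, a ≤ j.val → j.val < a + M → pos j ≠ i} ≤
      ENNReal.ofReal (Real.exp (-(1 / ((n - 1 : ℕ) : ℝ)))) ^ M := by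
  have hm : 0 < n - 1 := by omega
  have := unif_prob hm
  have hset : {pos : Fin R → Fin (n - 1) | ∀ j : Fin R, a ≤ j.val → j.val < a + M → pos j ≠ i} =
      Set.pi Set.univ fun j : Fin R => if a ≤ j.val ∧ j.val < a + M then {i}ᶜ else Set.univ := by
    ext pos
    simp only [Set.mem_pi, Set.mem_univ, forall_true_left]
    refine forall_congr' fun j => ?_
    split_ifs with h
    · simp [h.1, h.2]
    · simp only [Set.mem_univ, iff_true]
      intro h1 h2; exact absurd ⟨h1, h2⟩ h
  rw [hset, mup, Measure.pi_pi]
  have hle : ∀ j : Fin R, uniformFin (n - 1) (if a ≤ j.val ∧ j.val < a + M then {i}ᶜ else Set.univ) ≤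
      if a ≤ j.val ∧ j.val < a + M then ENNReal.ofReal (Real.exp (-(1 / ((n - 1 : ℕ) : ℝ)))) else 1 := by
    intro j
    split_ifs
    · exact unif_compl hm i
    · exact prob_le_one
  refine (Finset.prod_le_prod' fun j _ => hle j).trans ?_
  rw [Finset.prod_ite, Finset.prod_const, Finset.prod_const_one, mul_one]
  have hcard : (Finset.univ.filter fun j : Fin R => a ≤ j.val ∧ j.val < a + M).card = M := by
    have : (Finset.univ.filter fun j : Fin R => a ≤ j.val ∧ j.val < a + M).map Fin.valEmbedding =
        Finset.Ico a (a + M) := by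
      ext k
      simp only [Finset.mem_map, Finset.mem_filter, Finset.mem_univ, true_and, Finset.mem_Ico,
        Fin.valEmbedding_apply]
      constructor
      · rintro ⟨j, hj, rfl⟩; exact hj
      · intro hk; exact ⟨⟨k, by omega⟩, hk, rfl⟩
    rw [← Finset.card_map Fin.valEmbedding, this]; simp
  rw [hcard]

lemma fail_prob (hn : 2 ≤ n) (lo : ℕ) (hlo : lo + (n - 1) * (n * (n - 1)) ≤ R) :
    mup n R {pos | ¬ Blk n (extp hn pos) lo} ≤
      ENNReal.ofReal (((n : ℝ) - 1) * Real.exp (-(n : ℝ))) := by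
  have hsub : {pos : Fin R → Fin (n - 1) | ¬ Blk n (extp hn pos) lo} ⊆
      ⋃ i : Fin (n - 1), {pos | ∀ j : Fin R, lo + i * (n * (n - 1)) ≤ j.val →
        j.val < lo + i * (n * (n - 1)) + n * (n - 1) → pos j ≠ i} := by
    intro pos hpos
    have hpos' : ¬ Blk n (extp hn pos) lo := hpos
    rw [Blk] at hpos'
    push Not at hpos'
    obtain ⟨i, hi⟩ := hpos'
    refine Set.mem_iUnion.mpr ⟨i, fun j h1 h2 => ?_⟩
    have := hi j h1 (by rw [add_mul, one_mul]; omega)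
    rwa [extp_val] at this
  have hpow : ENNReal.ofReal (Real.exp (-(1 / ((n - 1 : ℕ) : ℝ)))) ^ (n * (n - 1)) =
      ENNReal.ofReal (Real.exp (-(n : ℝ))) := by
    rw [← ENNReal.ofReal_pow (Real.exp_nonneg _), ← Real.exp_nat_mul]
    congr 2
    have : ((n - 1 : ℕ) : ℝ) ≠ 0 := by
      have : n - 1 ≠ 0 := by omega
      exact_mod_cast this
    push_cast
    field_simp
  calc mup n R {pos | ¬ Blk n (extp hn pos) lo}
      ≤ ∑ i : Fin (n - 1), mup n R {pos | ∀ j : Fin R, lo + i * (n * (n - 1)) ≤ j.val →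
        j.val < lo + i * (n * (n - 1)) + n * (n - 1) → pos j ≠ i} :=
        (measure_mono hsub).trans (measure_iUnion_fintype_le _ _)
    _ ≤ ∑ _i : Fin (n - 1), ENNReal.ofReal (Real.exp (-(n : ℝ))) := by
        refine Finset.sum_le_sum fun i _ => ?_
        rw [← hpow]
        refine window_prob hn _ _ ?_ i
        have h1 : (i.val + 1) * (n * (n - 1)) ≤ (n - 1) * (n * (n - 1)) :=
          Nat.mul_le_mul_right _ i.isLt
        rw [add_mul, one_mul] at h1
        omega
    _ = ENNReal.ofReal (((n : ℝ) - 1) * Real.exp (-(n : ℝ))) := by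
        rw [Finset.sum_const, Finset.card_univ, Fintype.card_fin, nsmul_eq_mul,
          ← ENNReal.ofReal_natCast, ← ENNReal.ofReal_mul (by positivity), Nat.cast_sub (by omega)]
        simp

lemma bad_prob (hn : 2 ≤ n) (B : ℕ) (hB : B * ((n - 1) * (n * (n - 1))) ≤ R) {α : ℝ}
    (hα1 : α < 1) :
    mup n R {pos | (sc n (extp hn pos) B : ℝ) < α * B} ≤
      ENNReal.ofReal (((n : ℝ) - 1) * Real.exp (-(n : ℝ)) / (1 - α)) := by
  set q := ((n : ℝ) - 1) * Real.exp (-(n : ℝ)) with hq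
  rcases Nat.eq_zero_or_pos B with h0 | hB0
  · have : {pos : Fin R → Fin (n - 1) | (sc n (extp hn pos) B : ℝ) < α * B} = ∅ := by
      ext pos
      simp [h0]
    rw [this]; simp
  have hB0' : (0 : ℝ) < B := by exact_mod_cast hB0
  let L := (n - 1) * (n * (n - 1))
  let f : (Fin R → Fin (n - 1)) → ℝ≥0∞ := fun pos =>
    ∑ b ∈ Finset.range B, Set.indicator {pos | ¬ Blk n (extp hn pos) (b * L)} 1 pos
  have hf : ∀ pos, f pos = ((B - sc n (extp hn pos) B : ℕ) : ℝ≥0∞) := by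
    intro pos
    have h1 : f pos = (((Finset.range B).filter fun b => ¬ Blk n (extp hn pos) (b * L)).card : ℝ≥0∞) := by
      rw [Finset.card_filter, Nat.cast_sum]
      refine Finset.sum_congr rfl fun b _ => ?_
      by_cases hb : Blk n (extp hn pos) (b * L) <;> simp [hb, Set.indicator]
    rw [h1]
    congr 1
    have := Finset.card_filter_add_card_filter_not (s := Finset.range B)
      (fun b => Blk n (extp hn pos) (b * L))
    rw [Finset.card_range] at this
    change sc n (extp hn pos) B + _ = B at this
    omega
  have hint : ∫⁻ pos, f pos ∂(mup n R) ≤ B * ENNReal.ofReal q := by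
    rw [lintegral_finsetSum _ fun b _ => Measurable.of_discrete]
    calc _ ≤ ∑ b ∈ Finset.range B, ENNReal.ofReal q := by
          refine Finset.sum_le_sum fun b hb => ?_
          rw [lintegral_indicator_one (MeasurableSet.of_discrete)]
          refine fail_prob hn _ (le_trans ?_ hB)
          have : (b + 1) * L ≤ B * L := Nat.mul_le_mul_right _ (Finset.mem_range.mp hb)
          rw [add_mul, one_mul] at this
          exact this
      _ = _ := by simp
  have hmk := mul_meas_ge_le_lintegral (μ := mup n R) (Measurable.of_discrete (f := f))
    (ENNReal.ofReal ((1 - α) * B))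
  have hsub : {pos : Fin R → Fin (n - 1) | (sc n (extp hn pos) B : ℝ) < α * B} ⊆
      {pos | ENNReal.ofReal ((1 - α) * B) ≤ f pos} := by
    intro pos hpos
    have hpos' : (sc n (extp hn pos) B : ℝ) < α * B := hpos
    change ENNReal.ofReal ((1 - α) * B) ≤ f pos
    rw [hf, ← ENNReal.ofReal_natCast, Nat.cast_sub (sc_le _)]
    refine ENNReal.ofReal_le_ofReal ?_
    nlinarith
  have hpos : 0 < (1 - α) * B := mul_pos (by linarith) hB0'
  have hfin := (mul_le_mul_right (measure_mono (μ := mup n R) hsub)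
    (ENNReal.ofReal ((1 - α) * B))).trans (hmk.trans hint)
  have heq : (B : ℝ≥0∞) * ENNReal.ofReal q =
      ENNReal.ofReal ((1 - α) * B) * ENNReal.ofReal (q / (1 - α)) := by
    rw [← ENNReal.ofReal_natCast, ← ENNReal.ofReal_mul hB0'.le, ← ENNReal.ofReal_mul hpos.le]
    congr 1
    have : 1 - α ≠ 0 := by linarith
    field_simp
  rw [heq] at hfin
  exact (ENNReal.mul_le_mul_iff_right (by simpa using hpos) ENNReal.ofReal_ne_top).mp hfin

end RA

namespace RA

variable {n R : ℕ}

lemma good_null (hn : 2 ≤ n) {α : ℝ} (hα0 : 0 ≤ α) (hα1 : α < 1)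
    (hbound : α * R / ((n : ℝ) * ((n : ℝ) - 1) ^ 2) ≤ 4 ^ n - 1)
    (pos : Fin R → Fin (n - 1))
    (hgood : α * ((R / ((n - 1) * (n * (n - 1))) : ℕ) : ℝ) ≤
      sc n (extp hn pos) (R / ((n - 1) * (n * (n - 1))))) :
    (Measure.pi fun _ : Fin R => haarSU4)
      {x | ¬ (α * (R : ℝ) / (9 * (n : ℝ) * ((n : ℝ) - 1) ^ 2) - (n : ℝ) / 3 ≤
          (Cu n (contract (archOfPositions hn pos) x) : ℝ))} = 0 := by
  set L := (n - 1) * (n * (n - 1)) with hLdef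
  have hL : 0 < L := nn_pos hn
  have hLr : (L : ℝ) = (n : ℝ) * ((n : ℝ) - 1) ^ 2 := by
    rw [hLdef]; push_cast [Nat.cast_sub (show 1 ≤ n by omega)]; ring
  have hLr0 : (0 : ℝ) < L := by exact_mod_cast hL
  have h9 : α * (R : ℝ) / (9 * (n : ℝ) * ((n : ℝ) - 1) ^ 2) = α * R / L / 9 := by
    rw [mul_assoc, ← hLr, div_div, mul_comm (9 : ℝ)]
  rw [← hLr] at hbound
  have hlt : (R : ℝ) / L < (R / L : ℕ) + 1 := by
    rw [div_lt_iff₀ hLr0]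
    have := Nat.lt_div_mul_add hL (a := R)
    have h2 : R < (R / L + 1) * L := by rw [add_mul, one_mul]; exact this
    exact_mod_cast h2
  set B := R / L with hBdef
  have hX : α * R / L ≤ 1 + (sc n (extp hn pos) B : ℝ) := by
    rw [mul_div_assoc]
    have : α * (R / L) ≤ α * (B + 1) := mul_le_mul_of_nonneg_left hlt.le hα0
    nlinarith
  have hn' : (2 : ℝ) ≤ n := by exact_mod_cast hn
  simp only [not_le, h9]
  rcases Nat.eq_zero_or_pos B with h0 | hB
  · have hs : sc n (extp hn pos) B = 0 := by
      have := sc_le (n := n) (pos := extp hn pos) B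
      omega
    rw [hs] at hX
    convert measure_empty (μ := Measure.pi fun _ : Fin R => haarSU4)
    ext x
    simp only [Set.mem_empty_iff_false, iff_false]
    intro hx
    have hx' : (Cu n (contract (archOfPositions hn pos) x) : ℝ) < α * R / L / 9 - n / 3 := hx
    have hc : (0 : ℝ) ≤ Cu n (contract (archOfPositions hn pos) x) := Nat.cast_nonneg _
    push_cast at hX
    linarith
  obtain ⟨k, hk⟩ : ∃ k, B = k + 1 := ⟨B - 1, by omega⟩
  have hdim := blocks_dim (pos := extp hn pos) hn k
  rw [← hk, ← hLdef] at hdim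
  have harch : (archOfPositions hn fun i : Fin R => extp hn pos i) = archOfPositions hn pos := by
    congr 1
    funext i
    exact extp_val hn pos i
  have hdim' : DimGE (Set.range (contract (archOfPositions hn pos)))
      (min (1 + sc n (extp hn pos) B) (4 ^ n - 1)) := by
    refine hdim.mono le_rfl fun U hU => ?_
    have hid := Mv.id (hn := hn) (pos := extp hn pos) (show B * L ≤ R from Nat.div_mul_le_self _ _) U hU
    rw [one_mul] at hid
    obtain ⟨x, hx⟩ := reach_contract hn _ R U hid
    rw [harch] at hx
    exact ⟨x, hx⟩
  refine measure_mono_null ?_ (cu_null _ hdim')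
  intro x hx
  have hx' : (Cu n (contract (archOfPositions hn pos) x) : ℝ) < α * R / L / 9 - n / 3 := hx
  change 9 * Cu n (contract (archOfPositions hn pos) x) + 3 * n < _
  rw [lt_min_iff]
  constructor
  · have : ((9 * Cu n (contract (archOfPositions hn pos) x) + 3 * n : ℕ) : ℝ) <
        ((1 + sc n (extp hn pos) B : ℕ) : ℝ) := by
      push_cast; linarith
    exact_mod_cast this
  · have : ((9 * Cu n (contract (archOfPositions hn pos) x) + 3 * n : ℕ) : ℝ) <
        ((4 ^ n - 1 : ℕ) : ℝ) := by
      rw [Nat.cast_sub (Nat.one_le_pow _ _ (by norm_num))]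
      push_cast; linarith
    exact_mod_cast this

end RA

/-- **Randomized architectures.**  Draw an `n`-qubit unitary `U` by applying `R` Haar-random
two-qubit gates at independent, uniformly random neighboring positions.  For every
`α ∈ [0, 1)` (such that `α R / (n(n−1)²) ≤ 4^n − 1`), with probability at least
`1 − (n−1)e^{−n}/(1−α)`, the complexity obeys `C_u(U) ≥ α R/(9n(n−1)²) − n/3`. -/
theorem randomized_architectures
    (n R : ℕ) (hn : 2 ≤ n) (α : ℝ) (hα0 : 0 ≤ α) (hα1 : α < 1)
    (hbound : α * R / ((n : ℝ) * ((n : ℝ) - 1) ^ 2) ≤ 4 ^ n - 1) :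
    ENNReal.ofReal (1 - ((n : ℝ) - 1) * Real.exp (-(n : ℝ)) / (1 - α)) ≤
      muDoublyRandom n R
        {ω | α * (R : ℝ) / (9 * (n : ℝ) * ((n : ℝ) - 1) ^ 2) - (n : ℝ) / 3 ≤
          (Cu n (contract (archOfPositions hn ω.1) ω.2) : ℝ)} := by
  set S : Set ((Fin R → Fin (n - 1)) × (Fin R → SU4)) :=
    {ω | α * (R : ℝ) / (9 * (n : ℝ) * ((n : ℝ) - 1) ^ 2) - (n : ℝ) / 3 ≤
          (Cu n (contract (archOfPositions hn ω.1) ω.2) : ℝ)} with hS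
  set B := R / ((n - 1) * (n * (n - 1))) with hB
  set q := ((n : ℝ) - 1) * Real.exp (-(n : ℝ)) / (1 - α) with hq
  have := RA.unif_prob (show 0 < n - 1 by omega)
  let bad : Set (Fin R → Fin (n - 1)) := {pos | (RA.sc n (RA.extp hn pos) B : ℝ) < α * B}
  have hcov : Sᶜ ⊆ bad ×ˢ Set.univ ∪ ⋃ pos ∈ badᶜ, {pos} ×ˢ {x | (pos, x) ∉ S} := by
    rintro ⟨pos, x⟩ hx
    by_cases hb : pos ∈ bad
    · exact Or.inl ⟨hb, Set.mem_univ _⟩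
    · refine Or.inr ?_
      simp only [Set.mem_iUnion]
      exact ⟨pos, hb, rfl, hx⟩
  have hnull : muDoublyRandom n R (⋃ pos ∈ badᶜ, {pos} ×ˢ {x | (pos, x) ∉ S}) = 0 := by
    refine (measure_biUnion_null_iff (Set.to_countable _)).mpr fun pos hpos => ?_
    rw [muDoublyRandom, Measure.prod_prod]
    have h0 : (Measure.pi fun _ : Fin R => haarSU4) {x | (pos, x) ∉ S} = 0 :=
      RA.good_null hn hα0 hα1 hbound pos (not_lt.mp hpos)
    rw [h0, mul_zero]
  have hbad : muDoublyRandom n R (bad ×ˢ Set.univ) ≤ ENNReal.ofReal q := by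
    rw [muDoublyRandom, Measure.prod_prod, measure_univ, mul_one]
    exact RA.bad_prob hn B (Nat.div_mul_le_self _ _) hα1
  have hcompl : muDoublyRandom n R Sᶜ ≤ ENNReal.ofReal q := by
    refine (measure_mono hcov).trans ((measure_union_le _ _).trans ?_)
    rw [hnull, add_zero]
    exact hbad
  have huniv : (1 : ℝ≥0∞) ≤ muDoublyRandom n R S + muDoublyRandom n R Sᶜ := by
    have h1 : muDoublyRandom n R Set.univ = 1 := by
      rw [muDoublyRandom]; exact measure_univ
    rw [← h1, ← Set.union_compl_self S]
    exact measure_union_le _ _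
  have hq0 : 0 ≤ q := by
    have : (2 : ℝ) ≤ n := by exact_mod_cast hn
    exact div_nonneg (mul_nonneg (by linarith) (Real.exp_nonneg _)) (by linarith)
  rw [ENNReal.ofReal_sub _ hq0, ENNReal.ofReal_one]
  refine tsub_le_iff_right.mpr (huniv.trans ?_)
  gcongr
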